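/- Let $K$ be an algebraically closed field of characteristic $0$ that is complete with respect to a non-trivial (possibly non-archimedean) absolute value $|\cdot|$, and let $f\in K(z)$ be a rational function of degree $d>1$. Write $\mathbb{N}=\{1,2,\dots\}$. Let $[z,w]=|p_0q_1-p_1q_0|/(\|p\|\,\|q\|)$ be the normalized chordal metric on $\mathbb{P}^1=\mathbb{P}^1(K)$, where $p,q\in K^2\setminus\{0\}$ are homogeneous coordinates of $z,w$ and $\|\cdot\|$ is the maximum norm on $K^2$ if $K$ is non-archimedean and the Euclidean norm $\sqrt{|p_0|^2+|p_1|^2}$ if $K$ is archimedean. Let $\mathsf{P}^1$ be the Berkovich projective line over $K$, which contains $\mathbb{P}^1$ (and equals it if $K$ is archimedean), with its usual (compact Hausdorff) topology; $f$ extends continuously to $\mathsf{P}^1$. Let $E(f)=\{a\in\mathbb{P}^1:\#\bigcup_{n\in\mathbb{N}}f^{-n}(a)<\infty\}$ be the exceptional set. The Berkovich Julia set of $f$ is $$\mathsf{J}(f)=\Big\{\mathcal{S}\in\mathsf{P}^1:\ \bigcap_{V\ni\mathcal{S},\ V\text{ open in }\mathsf{P}^1}\ \bigcup_{n\in\mathbb{N}}f^n(V)=\mathsf{P}^1\setminus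 E(f)\Big\},$$ and the Berkovich Fatou set of $f$ is $\mathsf{F}(f)=\mathsf{P}^1\setminus\mathsf{J}(f)$. A critical point of a rational function $g$ is a point of $\mathbb{P}^1$ at which $g'$, computed in affine coordinates, vanishes; a superattracting periodic point of $f$ is a point $c\in\mathbb{P}^1$ such that, for some $n\in\mathbb{N}$, $f^n(c)=c$ and $c$ is a critical point of $f^n$. If $c'\in\mathbb{P}^1$ is a critical point of $f$ that lies in $\mathsf{F}(f)$ and is not a superattracting periodic point of $f$, then $\liminf_{n\to\infty}[f^n(c'),c']>0$. -/

import Mathlib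

open Filter Topology
open scoped LinearAlgebra.Projectivization

noncomputable section

namespace BerkDyn

/-- The classical projective line `ℙ¹(K)`: lines in `K²`. The affine point `z ∈ K` is `[z : 1]`,
and `∞` is `[1 : 0]`. -/
abbrev P1 (K : Type*) [Field K] : Type _ := ℙ K (Fin 2 → K)

section Chordal

variable {K : Type*} [NontriviallyNormedField K]

open Classical in
/-- The norm on `K²` used for the chordal metric: the maximum norm if `K` is non-archimedean,
the Euclidean norm if `K` is archimedean. -/
def vecNorm (p : Fin 2 → K) : ℝ :=
  if IsUltrametricDist K then max ‖p 0‖ ‖p 1‖ else Real.sqrt (‖p 0‖ ^ 2 + ‖p 1‖ ^ 2)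

/-- The normalized chordal metric `[z,w] = |p ∧ q| / (‖p‖ ‖q‖)`, where `p` and `q` are
homogeneous coordinates of `z` and `w` (the value does not depend on their choice). -/
def chordal (z w : P1 K) : ℝ :=
  ‖z.rep 0 * w.rep 1 - z.rep 1 * w.rep 0‖ / (vecNorm z.rep * vecNorm w.rep)

end Chordal

section Critical

/-- The affine coordinate `p_{i+1} / p_i` on the standard chart `{p_i ≠ 0}` of `ℙ¹`
(indices modulo `2`). -/
def coord {K : Type*} [Field K] (i : Fin 2) (z : P1 K) : K := z.rep (i + 1) / z.rep i

/-- The inverse of the standard chart `{p_i ≠ 0} → K`: the point with `p_i = 1` and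
`p_{i+1} = t`. -/
def ofCoord {K : Type*} [Field K] (i : Fin 2) (t : K) : P1 K :=
  Projectivization.mk K (fun j => if j = i then 1 else t)
    (fun h => one_ne_zero (α := K) (by simpa using congrFun h i))

/-- The critical points of a self-map `g` of `ℙ¹` that is analytic (in the applications, an
iterate of a rational function): the points `c` at which the derivative of `g`, computed in
standard affine charts around `c` and `g c`, vanishes. -/
def critSet {K : Type*} [NontriviallyNormedField K] (g : P1 K → P1 K) : Set (P1 K) :=
  {c | ∃ i j : Fin 2, c.rep i ≠ 0 ∧ (g c).rep j ≠ 0 ∧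
    HasDerivAt (fun t : K => coord j (g (ofCoord i t))) 0 (coord i c)}

end Critical

section Lift

variable {K : Type*} [Field K]

/-- The degree of a rational function: the maximum of the degrees of numerator and denominator
in lowest terms. -/
def ratDegree (f : RatFunc K) : ℕ := max f.num.natDegree f.denom.natDegree

/-- The homogeneous lift `F = (F₀, F₁)` of `f` of degree `d = ratDegree f`: the
degree `d` homogenizations of the numerator and the denominator of `f`. -/
def homLift (f : RatFunc K) : Fin 2 → MvPolynomial (Fin 2) K :=
  ![f.num.homogenize (ratDegree f), f.denom.homogenize (ratDegree f)]

theorem homLift_isHomogeneous (f : RatFunc K) (i : Fin 2) :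
    (homLift f i).IsHomogeneous (ratDegree f) := by
  fin_cases i <;> simp [homLift]

end Lift

section Berkovich

variable {K : Type*} [NontriviallyNormedField K]

/-- The multiplicative seminorms on `K[X₀, X₁]` that extend the absolute value of `K` and do not
vanish identically on the ideal `(X₀, X₁)`. -/
structure PreBerk (K : Type*) [NontriviallyNormedField K] where
  /-- the underlying multiplicative seminorm -/
  nrm : MulRingSeminorm (MvPolynomial (Fin 2) K)
  map_C : ∀ a : K, nrm (MvPolynomial.C a) = ‖a‖
  ne_zero : ∃ i, nrm (MvPolynomial.X i) ≠ 0

theorem homLift_ne_zero_aux (x : MulRingSeminorm (MvPolynomial (Fin 2) K))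
    (hC : ∀ a : K, x (MvPolynomial.C a) = ‖a‖) (hx0 : x (MvPolynomial.X 0) ≠ 0)
    (hx1 : x (MvPolynomial.X 1) = 0) (p : Polynomial K) (hp : p ≠ 0) :
    x (p.homogenize p.natDegree) ≠ 0 := by
  have key : ∃ Q : MvPolynomial (Fin 2) K, p.homogenize p.natDegree =
      MvPolynomial.C p.leadingCoeff * MvPolynomial.X 0 ^ p.natDegree
        + Q * MvPolynomial.X 1 := by
    have h1 : p.homogenize p.natDegree = p.eraseLead.homogenize p.natDegree +
        MvPolynomial.C p.leadingCoeff * MvPolynomial.X 0 ^ p.natDegree := by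
      conv_lhs => rw [← p.eraseLead_add_C_mul_X_pow]
      rw [Polynomial.homogenize_add, p.eraseLead_add_C_mul_X_pow, Polynomial.homogenize_C_mul,
        Polynomial.homogenize_X_pow le_rfl]
      simp
    rcases Nat.eq_zero_or_pos p.natDegree with h0 | h0
    · refine ⟨0, ?_⟩
      have : p.eraseLead = 0 := by
        rw [Polynomial.eq_C_of_natDegree_eq_zero h0]; simp
      rw [h1, this]; simp
    · refine ⟨p.eraseLead.homogenize (p.natDegree - 1), ?_⟩
      have h2 := Polynomial.homogenize_mul p.eraseLead 1 p.eraseLead_natDegree_le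
        (n := 1) (by simp)
      rw [mul_one, Nat.sub_add_cancel h0, Polynomial.homogenize_one, pow_one] at h2
      rw [h1, h2, add_comm]
  obtain ⟨Q, hQ⟩ := key
  intro h
  have h3 : MvPolynomial.C p.leadingCoeff * MvPolynomial.X 0 ^ p.natDegree =
      p.homogenize p.natDegree + -(Q * MvPolynomial.X 1) := by rw [hQ]; ring
  have h4 : x (MvPolynomial.C p.leadingCoeff * MvPolynomial.X 0 ^ p.natDegree) ≤ 0 := by
    rw [h3]
    refine (map_add_le_add x _ _).trans ?_
    rw [map_neg_eq_map, map_mul x, hx1, h]; simp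
  rw [map_mul x, map_pow, hC] at h4
  have h5 : 0 < ‖p.leadingCoeff‖ := norm_pos_iff.mpr (Polynomial.leadingCoeff_ne_zero.mpr hp)
  have h6 : 0 < x (MvPolynomial.X 0) := lt_of_le_of_ne (apply_nonneg x _) (Ne.symm hx0)
  exact absurd h4 (not_le.mpr (by positivity))

/-- Non-degeneracy of the lift: the two components have no common zero. -/
theorem homLift_ne_zero (f : RatFunc K) (x : PreBerk K) : ∃ i, x.nrm (homLift f i) ≠ 0 := by
  by_contra! h
  have hn : x.nrm (f.num.homogenize (ratDegree f)) = 0 := h 0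
  have hd : x.nrm (f.denom.homogenize (ratDegree f)) = 0 := h 1
  have hdn : f.num.natDegree ≤ ratDegree f := le_max_left _ _
  have hdd : f.denom.natDegree ≤ ratDegree f := le_max_right _ _
  have h1 : x.nrm (MvPolynomial.X 1) = 0 := by
    obtain ⟨u, v, huv⟩ := f.isCoprime_num_denom
    have hu := Polynomial.homogenize_mul u f.num (le_max_left u.natDegree v.natDegree) hdn
    have hv := Polynomial.homogenize_mul v f.denom (le_max_right u.natDegree v.natDegree) hdd
    have h2 := Polynomial.homogenize_one (R := K) (max u.natDegree v.natDegree + ratDegree f)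
    rw [← huv, Polynomial.homogenize_add, hu, hv] at h2
    have h3 : x.nrm (MvPolynomial.X 1 ^ (max u.natDegree v.natDegree + ratDegree f)) ≤ 0 := by
      rw [← h2]
      refine (map_add_le_add x.nrm _ _).trans ?_
      rw [map_mul x.nrm, map_mul x.nrm, hn, hd]; simp
    rw [map_pow] at h3
    exact eq_zero_of_pow_eq_zero (le_antisymm h3 (pow_nonneg (apply_nonneg x.nrm _) _))
  have h0 : x.nrm (MvPolynomial.X 0) ≠ 0 := by
    obtain ⟨i, hi⟩ := x.ne_zero
    fin_cases i
    · exact hi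
    · exact absurd h1 hi
  rcases le_or_gt f.num.natDegree f.denom.natDegree with hle | hlt
  · have : ratDegree f = f.denom.natDegree := max_eq_right hle
    rw [this] at hd
    exact homLift_ne_zero_aux x.nrm x.map_C h0 h1 f.denom f.denom_ne_zero hd
  · have : ratDegree f = f.num.natDegree := max_eq_left hlt.le
    rw [this] at hn
    refine homLift_ne_zero_aux x.nrm x.map_C h0 h1 f.num ?_ hn
    rintro h'
    rw [h'] at hlt
    simp at hlt

namespace PreBerk

/-- The seminorm `G ↦ |G(p)|` of a vector `p ∈ K² \ {0}`. -/
def ofVec (p : Fin 2 → K) (hp : p ≠ 0) : PreBerk K where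
  nrm :=
    { toFun := fun G => ‖MvPolynomial.eval p G‖
      map_zero' := by simp
      add_le' := fun a b => by simpa using norm_add_le _ _
      neg' := fun a => by simp
      map_one' := by simp
      map_mul' := fun a b => by simp }
  map_C := fun a => by
    change ‖MvPolynomial.eval p (MvPolynomial.C a)‖ = ‖a‖
    simp
  ne_zero := by
    by_contra! h
    refine hp (funext fun i => ?_)
    have : ‖MvPolynomial.eval p (MvPolynomial.X i)‖ = 0 := h i
    simpa using this

/-- The image of a seminorm under the lift of `f`: `|G|_{F(x)} = |G ∘ F|_x`. -/
def map (f : RatFunc K) (x : PreBerk K) : PreBerk K where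
  nrm :=
    { toFun := fun G => x.nrm (MvPolynomial.aeval (homLift f) G)
      map_zero' := by simp
      add_le' := fun a b => by simpa using map_add_le_add x.nrm _ _
      neg' := fun a => by simp [map_neg_eq_map]
      map_one' := by simp
      map_mul' := fun a b => by simp }
  map_C := fun a => by
    change x.nrm (MvPolynomial.aeval (homLift f) (MvPolynomial.C a)) = ‖a‖
    rw [MvPolynomial.aeval_C]
    exact x.map_C a
  ne_zero := by
    obtain ⟨i, hi⟩ := homLift_ne_zero f x
    refine ⟨i, ?_⟩
    change x.nrm (MvPolynomial.aeval (homLift f) (MvPolynomial.X i)) ≠ 0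
    rwa [MvPolynomial.aeval_X]

/-- Two seminorms are identified if, for some `C > 0`, they differ by the factor `C ^ n` on
homogeneous polynomials of degree `n`, for every `n`. -/
instance setoid (K : Type*) [NontriviallyNormedField K] : Setoid (PreBerk K) where
  r x y := ∃ C : ℝ, 0 < C ∧ ∀ (n : ℕ) (G : MvPolynomial (Fin 2) K), G.IsHomogeneous n →
    x.nrm G = C ^ n * y.nrm G
  iseqv :=
    { refl := fun x => ⟨1, one_pos, fun n G _ => by simp⟩
      symm := by
        rintro x y ⟨C, hC, h⟩
        refine ⟨C⁻¹, inv_pos.mpr hC, fun n G hG => ?_⟩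
        rw [h n G hG, ← mul_assoc, ← mul_pow, inv_mul_cancel₀ hC.ne', one_pow, one_mul]
      trans := by
        rintro x y z ⟨C, hC, h⟩ ⟨D, hD, h'⟩
        refine ⟨C * D, mul_pos hC hD, fun n G hG => ?_⟩
        rw [h n G hG, h' n G hG, mul_pow, mul_assoc] }

theorem map_equiv (f : RatFunc K) {x y : PreBerk K} (h : x ≈ y) : map f x ≈ map f y := by
  obtain ⟨C, hC, h⟩ := h
  refine ⟨C ^ ratDegree f, pow_pos hC _, fun n G hG => ?_⟩
  rw [← pow_mul]
  exact h _ _ (hG.aeval (homLift f) (homLift_isHomogeneous f))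

/-- The normalized value `|G|_x / max(|X₀|_x, |X₁|_x)ⁿ` of a homogeneous polynomial `G` of
degree `n`; it depends on the class of `x` only. -/
def normVal (n : ℕ) (G : MvPolynomial (Fin 2) K) (x : PreBerk K) : ℝ :=
  x.nrm G / max (x.nrm (MvPolynomial.X 0)) (x.nrm (MvPolynomial.X 1)) ^ n

theorem normVal_equiv (n : ℕ) (G : MvPolynomial (Fin 2) K) (hG : G.IsHomogeneous n)
    {x y : PreBerk K} (h : x ≈ y) : normVal n G x = normVal n G y := by
  obtain ⟨C, hC, h⟩ := h
  have h0 := h 1 _ (MvPolynomial.isHomogeneous_X K (0 : Fin 2))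
  have h1 := h 1 _ (MvPolynomial.isHomogeneous_X K (1 : Fin 2))
  rw [pow_one] at h0 h1
  rw [normVal, normVal, h n G hG, h0, h1, ← mul_max_of_nonneg _ _ hC.le, mul_pow,
    mul_div_mul_left _ _ (pow_pos hC n).ne']

end PreBerk

/-- The Berkovich projective line `𝖯¹(K)` (the Proj construction). For archimedean `K` every
multiplicative seminorm as above is evaluation at a vector, and `𝖯¹(K) = ℙ¹(K)`. -/
def BerkP1 (K : Type*) [NontriviallyNormedField K] : Type _ := Quotient (PreBerk.setoid K)

namespace BerkP1

/-- The normalized value of a homogeneous polynomial of degree `n` at a point of `𝖯¹`. -/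
def normVal (n : ℕ) (G : MvPolynomial.homogeneousSubmodule (Fin 2) K n) : BerkP1 K → ℝ :=
  Quotient.lift (PreBerk.normVal n (G : MvPolynomial (Fin 2) K)) fun _ _ h =>
    PreBerk.normVal_equiv n _ ((MvPolynomial.mem_homogeneousSubmodule n _).mp G.2) h

/-- The topology of `𝖯¹`: the weakest one for which the normalized values of all homogeneous
polynomials are continuous. -/
instance : TopologicalSpace (BerkP1 K) :=
  ⨅ (n : ℕ) (G : MvPolynomial.homogeneousSubmodule (Fin 2) K n),
    TopologicalSpace.induced (normVal n G) inferInstance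

/-- The embedding `ℙ¹ → 𝖯¹`, sending `[p]` to the class of `G ↦ |G(p)|` (which does not depend
on the choice of the homogeneous coordinates `p`). -/
def ofP1 (z : P1 K) : BerkP1 K :=
  Quotient.mk (PreBerk.setoid K) (PreBerk.ofVec z.rep z.rep_nonzero)

/-- The extension of `f` to `𝖯¹`. -/
def map (f : RatFunc K) : BerkP1 K → BerkP1 K :=
  Quotient.map (PreBerk.map f) fun _ _ h => PreBerk.map_equiv f h

end BerkP1

/-- The action of `f` on `ℙ¹`: `f([p]) = [F(p)]` (which does not depend on the choice of the
homogeneous coordinates `p`). -/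
def ratMap (f : RatFunc K) (z : P1 K) : P1 K :=
  Projectivization.mk K (fun i => MvPolynomial.eval z.rep (homLift f i)) (by
    intro h
    obtain ⟨i, hi⟩ := homLift_ne_zero f (PreBerk.ofVec z.rep z.rep_nonzero)
    have h' : MvPolynomial.eval z.rep (homLift f i) = 0 := congrFun h i
    apply hi
    change ‖MvPolynomial.eval z.rep (homLift f i)‖ = 0
    rw [h', norm_zero])

/-- `SAT(f)`: the superattracting periodic points of `f` in `ℙ¹`, i.e. the fixed points of some
`fⁿ`, `n ≥ 1`, that are critical points of `fⁿ`. -/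
def superattracting (f : RatFunc K) : Set (P1 K) :=
  {c | ∃ n : ℕ, 1 ≤ n ∧ (ratMap f)^[n] c = c ∧ c ∈ critSet ((ratMap f)^[n])}

/-- The exceptional set `E(f)`: the classical points whose backward orbit under (the extended)
`f` is finite. -/
def exceptional (f : RatFunc K) : Set (BerkP1 K) :=
  {a | a ∈ Set.range (BerkP1.ofP1 (K := K)) ∧
    (⋃ n ∈ {n : ℕ | 1 ≤ n}, (BerkP1.map f)^[n] ⁻¹' {a}).Finite}

/-- The Berkovich Julia set of `f`: the points `S` such that the intersection, over all open
neighbourhoods `V` of `S`, of `⋃_{n ≥ 1} fⁿ(V)` is `𝖯¹ \ E(f)`. -/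
def julia (f : RatFunc K) : Set (BerkP1 K) :=
  {S | (⋂ V ∈ {V : Set (BerkP1 K) | IsOpen V ∧ S ∈ V},
    ⋃ n ∈ {n : ℕ | 1 ≤ n}, (BerkP1.map f)^[n] '' V) = (exceptional f)ᶜ}

/-- The Berkovich Fatou set of `f`. -/
def fatou (f : RatFunc K) : Set (BerkP1 K) := (julia f)ᶜ

end Berkovich

end BerkDyn

end

open Filter Topology
open scoped LinearAlgebra.Projectivization

noncomputable section

namespace BerkDyn

section Schottky

open Complex Metric

theorem exists_exp_eq_on_ball {u : ℂ → ℂ} {c : ℂ} {r : ℝ}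
    (hu : DifferentiableOn ℂ u (ball c r)) (h0 : ∀ z ∈ ball c r, u z ≠ 0) :
    ∃ L : ℂ → ℂ, DifferentiableOn ℂ L (ball c r) ∧ ∀ z ∈ ball c r, exp (L z) = u z := by
  rcases le_or_gt r 0 with hr | hr
  · exact ⟨0, by simp [ball_eq_empty.2 hr], by simp [ball_eq_empty.2 hr]⟩
  have hc : c ∈ ball c r := mem_ball_self hr
  have hd : DifferentiableOn ℂ (fun z => deriv u z / u z) (ball c r) :=
    (hu.deriv isOpen_ball).div hu h0
  obtain ⟨L, hL⟩ := hd.isExactOn_ball.with_val_at c (log (u c))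
  obtain ⟨hLc, hL⟩ := hL
  refine ⟨L, fun z hz => (hL z hz).differentiableAt.differentiableWithinAt, ?_⟩
  have hder : ∀ z ∈ ball c r, HasDerivAt (fun w => u w * exp (-L w)) 0 z := by
    intro z hz
    have h1 := (hu.differentiableAt (isOpen_ball.mem_nhds hz)).hasDerivAt
    have h2 := h1.mul (hL z hz).neg.cexp
    refine h2.congr_deriv ?_
    have := h0 z hz
    simp only [Pi.neg_apply]
    field_simp
    ring
  intro z hz
  have hconst : u z * exp (-L z) = u c * exp (-L c) :=
    isOpen_ball.is_const_of_deriv_eq_zero (convex_ball c r).isPreconnected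
      (fun w hw => (hder w hw).differentiableAt.differentiableWithinAt)
      (fun w hw => (hder w hw).deriv) hz hc
  rw [hLc, exp_neg, exp_neg, exp_log (h0 c hc), mul_inv_cancel₀ (h0 c hc)] at hconst
  have := exp_ne_zero (L z)
  field_simp at hconst
  exact hconst.symm

theorem abs_im_le_norm_cos (z : ℂ) : |z.im| ≤ ‖cos z‖ := by
  have h1 : ‖cos z‖ = ‖exp (z * I) + exp (-z * I)‖ / 2 := by simp [cos]
  have h2 := abs_norm_sub_norm_le (exp (z * I)) (-exp (-z * I))
  rw [sub_neg_eq_add, norm_neg, norm_exp, norm_exp] at h2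
  have h3 : |z.im| ≤ |Real.sinh z.im| := by
    rw [Real.abs_sinh]; exact Real.self_le_sinh_iff.2 (abs_nonneg _)
  have h4 : Real.sinh z.im = -((Real.exp (z * I).re - Real.exp (-z * I).re) / 2) := by
    rw [Real.sinh_eq]; simp; ring
  rw [h4, abs_neg, abs_div, abs_two] at h3
  rw [h1]; linarith

/-- A branch of `arccos`, suitably normalized at the centre, of a function omitting `±1`. -/
theorem exists_cos_eq_on_ball {u : ℂ → ℂ} {c : ℂ} {r : ℝ} (hr : 0 < r)
    (hu : DifferentiableOn ℂ u (ball c r))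
    (h1 : ∀ z ∈ ball c r, u z ≠ 1) (h2 : ∀ z ∈ ball c r, u z ≠ -1) :
    ∃ F : ℂ → ℂ, DifferentiableOn ℂ F (ball c r) ∧
      (∀ z ∈ ball c r, cos (Real.pi * F z) = u z) ∧ ‖F c‖ ≤ 1 + ‖u c‖ := by
  have hpi : (Real.pi : ℂ) ≠ 0 := by exact_mod_cast Real.pi_ne_zero
  obtain ⟨L, hL, hLu⟩ := exists_exp_eq_on_ball (u := fun z => 1 - u z ^ 2)
    ((differentiableOn_const _).sub (hu.pow 2)) (fun z hz h => by
      have : (1 - u z) * (1 + u z) = 0 := by linear_combination h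
      rcases mul_eq_zero.1 this with h' | h'
      · exact h1 z hz (by linear_combination -h')
      · exact h2 z hz (by linear_combination h'))
  have hs : ∀ z ∈ ball c r, exp (L z / 2) ^ 2 = 1 - u z ^ 2 := fun z hz => by
    rw [← hLu z hz, ← exp_nat_mul]; congr 1; push_cast; ring
  have hprod : ∀ z ∈ ball c r, (u z + I * exp (L z / 2)) * (u z - I * exp (L z / 2)) = 1 :=
    fun z hz => by linear_combination (hs z hz) - exp (L z / 2) ^ 2 * I_sq
  obtain ⟨G, hG, hGu⟩ := exists_exp_eq_on_ball (u := fun z => u z + I * exp (L z / 2)) (c := c)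
    (r := r) (hu.add ((hL.div_const 2).cexp.const_mul I)) (fun z hz h => by
      have := hprod z hz
      rw [h, zero_mul] at this
      exact zero_ne_one this)
  set k : ℤ := round ((G c / (I * Real.pi)).re / 2) with hk
  have hcos : ∀ z ∈ ball c r, cos (Real.pi * (G z / (I * Real.pi) - 2 * k)) = u z := by
    intro z hz
    have e1 : (Real.pi : ℂ) * (G z / (I * Real.pi) - 2 * k) = G z / I - k * (2 * Real.pi) := by
      field_simp
    rw [e1, cos_sub_int_mul_two_pi, cos]
    have e2 : G z / I * I = G z := by field_simp
    rw [neg_mul, e2, exp_neg, hGu z hz, inv_eq_of_mul_eq_one_right (hprod z hz)]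
    ring
  refine ⟨fun z => G z / (I * Real.pi) - 2 * k, (hG.div_const _).sub_const _, hcos, ?_⟩
  have hc := hcos c (mem_ball_self hr)
  set w : ℂ := G c / (I * Real.pi) - 2 * k with hw
  have hre : |w.re| ≤ 1 := by
    have h3 := abs_sub_round ((G c / (I * Real.pi)).re / 2)
    rw [← hk] at h3
    have : w.re = 2 * ((G c / (I * Real.pi)).re / 2 - k) := by
      rw [hw]; simp; ring
    rw [this, abs_mul, abs_two]; linarith
  have him : |w.im| ≤ ‖u c‖ := by
    have h3 := abs_im_le_norm_cos (Real.pi * w)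
    rw [hc] at h3
    have h4 : (Real.pi * w).im = Real.pi * w.im := by simp
    rw [h4, abs_mul, abs_of_pos Real.pi_pos] at h3
    have := Real.pi_gt_three
    nlinarith [abs_nonneg w.im]
  exact (norm_le_abs_re_add_abs_im w).trans (add_le_add hre him)

/-- Bloch's theorem, with a non-optimal constant. -/
theorem exists_ball_subset_image {h : ℂ → ℂ} {c : ℂ} {r : ℝ} (hr : 0 < r)
    (hd : DifferentiableOn ℂ h (ball c r)) :
    ∃ w : ℂ, ball w (r * ‖deriv h c‖ / 96) ⊆ h '' ball c r := by
  rcases eq_or_ne (deriv h c) 0 with h0 | h0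
  · exact ⟨0, by simp [h0]⟩
  have hd' : DifferentiableOn ℂ (deriv h) (ball c r) := hd.deriv isOpen_ball
  have hsub : closedBall c (r / 2) ⊆ ball c r := closedBall_subset_ball (by linarith)
  obtain ⟨z₁, hz₁, hmax⟩ := (isCompact_closedBall c (r / 2)).exists_isMaxOn
    ⟨c, mem_closedBall_self (by linarith)⟩
    (f := fun z => ‖deriv h z‖ * (r / 2 - dist z c))
    ((hd'.continuousOn.mono hsub).norm.mul (by fun_prop))
  have hM := hmax (mem_closedBall_self (by linarith : 0 ≤ r / 2))
  simp only [Set.mem_ofPred_eq, dist_self, sub_zero] at hM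
  have hpos : 0 < ‖deriv h c‖ * (r / 2) := mul_pos (norm_pos_iff.2 h0) (by linarith)
  have hz₁' : dist z₁ c ≤ r / 2 := hz₁
  set m := ‖deriv h z₁‖ with hm
  set ρ := (r / 2 - dist z₁ c) / 2 with hρ
  have hρm : 0 < m * (2 * ρ) := by
    have : r / 2 - dist z₁ c = 2 * ρ := by rw [hρ]; ring
    rw [this] at hM
    exact hpos.trans_le hM
  have hρ0 : 0 < ρ := by
    have : 0 ≤ ρ := by rw [hρ]; linarith
    rcases this.eq_or_lt with h' | h'
    · rw [← h'] at hρm; simp at hρm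
    · exact h'
  have hm0 : 0 < m := pos_of_mul_pos_left hρm (by linarith)
  have hball : ball z₁ ρ ⊆ closedBall c (r / 2) := fun z hz => by
    have h1 : dist z z₁ < ρ := hz
    have h2 := dist_triangle z z₁ c
    rw [mem_closedBall]; linarith
  have hbd : ∀ z ∈ ball z₁ ρ, ‖deriv h z‖ ≤ 2 * m := by
    intro z hz
    have h1 := hmax (hball hz)
    simp only [Set.mem_ofPred_eq] at h1
    have h2 : dist z z₁ < ρ := hz
    have h3 := dist_triangle z z₁ c
    have h4 : ρ ≤ r / 2 - dist z c := by linarith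
    have h5 : ‖deriv h z‖ * ρ ≤ m * (2 * ρ) := by
      calc ‖deriv h z‖ * ρ ≤ ‖deriv h z‖ * (r / 2 - dist z c) := by gcongr
        _ ≤ m * (r / 2 - dist z₁ c) := h1
        _ = m * (2 * ρ) := by rw [hρ]; ring
    nlinarith
  have hsch : ∀ z ∈ ball z₁ ρ, ‖deriv h z - deriv h z₁‖ ≤ 3 * m / ρ * dist z z₁ := by
    intro z hz
    rw [← dist_eq_norm]
    refine dist_le_div_mul_dist_of_mapsTo_ball (hd'.mono (hball.trans hsub)) ?_ hz
    intro w hw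
    rw [mem_closedBall, dist_eq_norm]
    have := hbd w hw
    have := norm_sub_le (deriv h w) (deriv h z₁)
    linarith
  have hsub6 : closedBall z₁ (ρ / 6) ⊆ ball z₁ ρ := closedBall_subset_ball (by linarith)
  have hmv : ∀ z ∈ sphere z₁ (ρ / 6), m * ρ / 12 ≤ ‖h z - h z₁‖ := by
    intro z hz
    have hz' : dist z z₁ = ρ / 6 := hz
    have h1 := (convex_closedBall z₁ (ρ / 6)).norm_image_sub_le_of_norm_hasDerivWithin_le
      (f := fun w => h w - deriv h z₁ * w) (f' := fun w => deriv h w - deriv h z₁) (C := m / 2)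
      (fun w hw => by
        have hw' : w ∈ ball c r := hsub (hball (hsub6 hw))
        have := (hd.differentiableAt (isOpen_ball.mem_nhds hw')).hasDerivAt
        exact (this.sub (((hasDerivAt_id w).const_mul _).congr_deriv (mul_one _))).hasDerivWithinAt)
      (fun w hw => by
        refine (hsch w (hsub6 hw)).trans ?_
        have hw' : dist w z₁ ≤ ρ / 6 := hw
        calc 3 * m / ρ * dist w z₁ ≤ 3 * m / ρ * (ρ / 6) := by gcongr
          _ = m / 2 := by field_simp; ring)
      (mem_closedBall_self (by linarith)) (sphere_subset_closedBall hz)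
    rw [← dist_eq_norm z z₁, hz'] at h1
    have h2 : ‖deriv h z₁ * (z - z₁)‖ = m * (ρ / 6) := by
      rw [norm_mul, ← dist_eq_norm z z₁, hz']
    have h3 : deriv h z₁ * (z - z₁) =
        (h z - h z₁) - (h z - deriv h z₁ * z - (h z₁ - deriv h z₁ * z₁)) := by ring
    have h4 := norm_sub_le (h z - h z₁) (h z - deriv h z₁ * z - (h z₁ - deriv h z₁ * z₁))
    rw [← h3, h2] at h4
    linarith
  have hz₁r : z₁ ∈ ball c r := hsub hz₁
  have hfreq : ∃ᶠ z in 𝓝 z₁, h z ≠ h z₁ := by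
    have h1 := (hd.differentiableAt (isOpen_ball.mem_nhds hz₁r)).hasDerivAt
    have h2 := h1.eventually_ne (c := h z₁) (norm_pos_iff.1 hm0)
    exact h2.frequently.filter_mono nhdsWithin_le_nhds
  have hcl : DiffContOnCl ℂ h (ball z₁ (ρ / 6)) := by
    refine DifferentiableOn.diffContOnCl (hd.mono ?_)
    rw [closure_ball _ (by linarith)]
    exact (hsub6.trans hball).trans hsub
  refine ⟨h z₁, (ball_subset_ball ?_).trans
    ((hcl.ball_subset_image_closedBall (by linarith) hmv hfreq).trans
      (Set.image_mono ((hsub6.trans hball).trans hsub)))⟩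
  have : m * (r / 2 - dist z₁ c) = m * (2 * ρ) := by rw [hρ]; ring
  linarith

theorem cos_intCast_mul_pi (m : ℤ) : cos ((m : ℂ) * Real.pi) = (-1) ^ m := by
  have := congrArg ((↑) : ℝ → ℂ) (Real.cos_int_mul_pi m)
  simpa using this

theorem exists_cos_pi_mul_eq_intCast (w : ℂ) :
    ∃ a ∈ ball w 2, ∃ n : ℤ, cos (Real.pi * a) = n := by
  obtain ⟨y, hy, n, hn⟩ : ∃ y : ℝ, |y - w.im| ≤ 1 ∧ ∃ n : ℤ, Real.cosh (Real.pi * y) = n := by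
    have key : ∀ x : ℝ, 0 ≤ x → ∃ y : ℝ, |y - x| ≤ 1 ∧ ∃ n : ℤ, Real.cosh (Real.pi * y) = n := by
      intro x hx
      have h1 : Real.cosh (Real.pi * x) + 1 ≤ Real.cosh (Real.pi * (x + 1)) := by
        rw [mul_add, mul_one, Real.cosh_add]
        have h2 : 2 ≤ Real.cosh Real.pi := by
          have h3 := Real.cosh_sq' Real.pi
          have h4 : Real.pi ≤ Real.sinh Real.pi := Real.self_le_sinh_iff.2 Real.pi_pos.le
          have h5 := Real.pi_gt_three
          nlinarith [Real.cosh_pos Real.pi]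
        have h3 := Real.one_le_cosh (Real.pi * x)
        have h4 : 0 ≤ Real.sinh (Real.pi * x) := Real.sinh_nonneg_iff.2 (by positivity)
        have h5 : 0 ≤ Real.sinh Real.pi := Real.sinh_nonneg_iff.2 Real.pi_pos.le
        nlinarith [mul_nonneg h4 h5]
      have hiv := intermediate_value_Icc (by linarith : x ≤ x + 1)
        (f := fun y => Real.cosh (Real.pi * y)) (by fun_prop)
      obtain ⟨y, hy, hyn⟩ := hiv (a := (⌈Real.cosh (Real.pi * x)⌉ : ℝ))
        ⟨Int.le_ceil _, ((Int.ceil_lt_add_one _).le).trans h1⟩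
      exact ⟨y, by rw [abs_le]; constructor <;> linarith [hy.1, hy.2], _, hyn⟩
    rcases le_total 0 w.im with h | h
    · exact key _ h
    · obtain ⟨y, hy, n, hn⟩ := key (-w.im) (by linarith)
      refine ⟨-y, ?_, n, by rw [mul_neg, Real.cosh_neg, hn]⟩
      rw [abs_sub_comm]; convert hy using 2; ring
  set m := round w.re with hm
  refine ⟨(m : ℝ) + (y : ℝ) * I, ?_, (if Even m then 1 else -1) * n, ?_⟩
  · rw [mem_ball, dist_eq_norm]
    refine (norm_le_abs_re_add_abs_im _).trans_lt ?_
    have h1 := abs_sub_round w.re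
    rw [← hm] at h1
    have e1 : ((m : ℝ) + (y : ℝ) * I - w).re = -(w.re - m) := by simp
    have e2 : ((m : ℝ) + (y : ℝ) * I - w).im = y - w.im := by simp
    rw [e1, e2, abs_neg]; linarith
  · have e : (Real.pi : ℂ) * ((m : ℝ) + (y : ℝ) * I) = m * Real.pi + (Real.pi * y : ℝ) * I := by
      push_cast; ring
    have hs : sin ((m : ℂ) * Real.pi) = 0 := by
      simpa using sin_int_mul_pi m
    have hc : cos ((m : ℂ) * Real.pi) = (if Even m then (1 : ℤ) else -1 : ℤ) := by
      rw [cos_intCast_mul_pi]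
      split_ifs with he
      · simp [he.neg_one_zpow]
      · simp [(Int.not_even_iff_odd.1 he).neg_one_zpow]
    rw [e, cos_add, hs, zero_mul, sub_zero, hc, cos_mul_I, ← ofReal_cosh]
    rw [hn]; push_cast; rfl

theorem norm_cos_le_exp_norm (z : ℂ) : ‖cos z‖ ≤ Real.exp ‖z‖ := by
  have h : cos z = (exp (z * I) + exp (-z * I)) / 2 := rfl
  have h1 : ‖exp (z * I)‖ ≤ Real.exp ‖z‖ := (norm_exp_le_exp_norm _).trans (by simp)
  have h2 : ‖exp (-z * I)‖ ≤ Real.exp ‖z‖ := (norm_exp_le_exp_norm _).trans (by simp)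
  rw [h, norm_div]
  have := norm_add_le (exp (z * I)) (exp (-z * I))
  simp only [norm_ofNat]
  linarith

/-- Schottky's theorem. -/
theorem exists_bound_of_omits (M : ℝ) : ∃ B : ℝ, 0 < B ∧ ∀ (R : ℝ) (g : ℂ → ℂ), 0 < R →
    DifferentiableOn ℂ g (ball 0 R) → (∀ z ∈ ball 0 R, g z ≠ 0) → (∀ z ∈ ball 0 R, g z ≠ 1) →
    ‖g 0‖ ≤ M → ∀ z ∈ ball 0 (R / 2), ‖g z‖ ≤ B := by
  refine ⟨1 + Real.exp (Real.pi * Real.exp (Real.pi * (2 * M + 3 + 192))), by positivity, ?_⟩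
  intro R g hR hg g0 g1 hgM
  obtain ⟨F, hF, hFu, hF0⟩ := exists_cos_eq_on_ball (u := fun z => 2 * g z - 1) hR
    ((hg.const_mul 2).sub_const 1) (fun z hz h => g1 z hz (by linear_combination h / 2))
    (fun z hz h => g0 z hz (by linear_combination h / 2))
  have hFint : ∀ z ∈ ball 0 R, ∀ n : ℤ, F z ≠ n := by
    intro z hz n h
    have h1 := hFu z hz
    rw [h, mul_comm, cos_intCast_mul_pi] at h1
    rcases Int.even_or_odd n with he | he
    · rw [he.neg_one_zpow] at h1
      exact g1 z hz (by linear_combination -h1 / 2)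
    · rw [he.neg_one_zpow] at h1
      exact g0 z hz (by linear_combination -h1 / 2)
  obtain ⟨G, hG, hGF, hG0⟩ := exists_cos_eq_on_ball hR hF
    (fun z hz h => hFint z hz 1 (by simpa using h))
    (fun z hz h => hFint z hz (-1) (by simpa using h))
  have hder : ∀ z ∈ ball (0 : ℂ) (R / 2), ‖deriv G z‖ ≤ 384 / R := by
    intro z hz
    have hsub : ball z (R / 2) ⊆ ball 0 R := ball_subset_ball' (by
      have : dist z 0 < R / 2 := hz
      linarith)
    obtain ⟨w, hw⟩ := exists_ball_subset_image (half_pos hR) (hG.mono hsub)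
    obtain ⟨a, ha, n, hn⟩ := exists_cos_pi_mul_eq_intCast w
    by_contra! hlt
    rw [div_lt_iff₀ hR] at hlt
    obtain ⟨x, hx, rfl⟩ := hw (ball_subset_ball (by nlinarith) ha)
    rw [hGF x (hsub hx)] at hn
    exact hFint x (hsub hx) n hn
  intro z hz
  have hz' : ‖z‖ < R / 2 := by simpa using hz
  have hsub : ball (0 : ℂ) (R / 2) ⊆ ball 0 R := ball_subset_ball (by linarith)
  have h1 := (convex_ball (0 : ℂ) (R / 2)).norm_image_sub_le_of_norm_deriv_le (f := G)
    (fun w hw => hG.differentiableAt (isOpen_ball.mem_nhds (hsub hw))) hder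
    (mem_ball_self (half_pos hR)) hz
  have h2 : ‖G z‖ ≤ 2 * M + 3 + 192 := by
    have h3 : 384 / R * ‖z - 0‖ ≤ 192 := by
      rw [sub_zero, div_mul_eq_mul_div, div_le_iff₀ hR]; linarith
    have h4 : ‖2 * g 0 - 1‖ ≤ 2 * M + 1 := by
      refine (norm_sub_le _ _).trans ?_
      simp; linarith
    have h5 := norm_sub_norm_le (G z) (G 0)
    linarith
  have h3 : ‖F z‖ ≤ Real.exp (Real.pi * (2 * M + 3 + 192)) := by
    rw [← hGF z (hsub hz)]
    refine (norm_cos_le_exp_norm _).trans (Real.exp_le_exp.2 ?_)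
    rw [norm_mul, norm_real, Real.norm_of_nonneg Real.pi_pos.le]
    gcongr
  have h4 : ‖2 * g z - 1‖ ≤ Real.exp (Real.pi * Real.exp (Real.pi * (2 * M + 3 + 192))) := by
    rw [← hFu z (hsub hz)]
    refine (norm_cos_le_exp_norm _).trans (Real.exp_le_exp.2 ?_)
    rw [norm_mul, norm_real, Real.norm_of_nonneg Real.pi_pos.le]
    gcongr
  have h5 : ‖(2 : ℂ) * g z‖ ≤ ‖2 * g z - 1‖ + 1 := by
    simpa using norm_add_le (2 * g z - 1) 1
  rw [norm_mul, norm_ofNat] at h5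
  have := Real.exp_pos (Real.pi * Real.exp (Real.pi * (2 * M + 3 + 192)))
  linarith [norm_nonneg (g z)]

/-- A function on a disc that omits `0` and `1` and is bounded and critical at the centre is
quadratically close to its value there, uniformly in the function. -/
theorem exists_sq_bound_of_omits (M R : ℝ) (hR : 0 < R) : ∃ C : ℝ, 0 < C ∧ ∀ g : ℂ → ℂ,
    DifferentiableOn ℂ g (ball 0 R) → (∀ z ∈ ball 0 R, g z ≠ 0) → (∀ z ∈ ball 0 R, g z ≠ 1) →
    ‖g 0‖ ≤ M → HasDerivAt g 0 0 → ∀ z ∈ ball 0 (R / 2), ‖g z - g 0‖ ≤ C * ‖z‖ ^ 2 := by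
  obtain ⟨B, hB, hbound⟩ := exists_bound_of_omits M
  refine ⟨2 * B * (2 / R) ^ 2, by positivity, fun g hg g0 g1 hgM hder z hz => ?_⟩
  have hb := hbound R g hR hg g0 g1 hgM
  have hb0 := hb 0 (mem_ball_self (half_pos hR))
  have := dist_le_mul_div_pow_of_mapsTo_ball_of_isLittleO (n := 1) (c := 0) (R₁ := R / 2)
    (R₂ := 2 * B) (hg.mono (ball_subset_ball (by linarith)))
    (fun w hw => by
      rw [mem_closedBall, dist_eq_norm]
      have := norm_sub_le (g w) (g 0)
      linarith [hb w hw])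
    (by
      have := hder.isLittleO
      simpa using this.norm_right) hz
  rw [dist_eq_norm, dist_zero_right] at this
  refine this.trans (le_of_eq ?_)
  rw [one_add_one_eq_two]
  field_simp

end Schottky

section Archimedean

open Polynomial in
theorem pow_natDegree_le_map_eval₂ {A : Type*} [CommRing A] (N : MulRingSeminorm A) (ψ : ℂ →+* A)
    {x : A} {m : ℝ} (hm : 0 ≤ m) (h : ∀ a, m ≤ N (x - ψ a)) {p : ℂ[X]} (hp : p.Monic) :
    m ^ p.natDegree ≤ N (p.eval₂ ψ x) := by
  have hs := IsAlgClosed.splits p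
  have key : ∀ S : Multiset ℂ,
      m ^ S.card ≤ N (((S.map fun a => X - C a).prod).eval₂ ψ x) := by
    intro S
    induction S using Multiset.induction_on with
    | empty => simp
    | cons a S ih =>
      rw [Multiset.map_cons, Multiset.prod_cons, eval₂_mul, map_mul, Multiset.card_cons, pow_succ']
      refine mul_le_mul ?_ ih (by positivity) (apply_nonneg _ _)
      simpa using h a
  have h1 := hs.eq_prod_roots
  rw [hp.leadingCoeff, C_1, one_mul] at h1
  have h2 := key p.roots
  rwa [← h1, ← hs.natDegree_eq_card_roots] at h2

open Polynomial in
/-- The Gelfand–Mazur argument, for a multiplicative seminorm that restricts to a power of the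
usual absolute value of `ℂ`. -/
theorem exists_map_sub_eq_zero {A : Type*} [CommRing A] (N : MulRingSeminorm A) (ψ : ℂ →+* A)
    {s : ℝ} (hs : 0 < s) (hN : ∀ w, N (ψ w) = ‖w‖ ^ s) (z : A) : ∃ a, N (z - ψ a) = 0 := by
  have hlow : ∀ a, ‖a‖ ^ s - N z ≤ N (z - ψ a) := by
    intro a
    have h1 := map_add_le_add N z (-(z - ψ a))
    rw [map_neg_eq_map, show z + -(z - ψ a) = ψ a by ring, hN] at h1
    linarith
  have hcont : Continuous fun a => N (z - ψ a) := by
    rw [continuous_iff_continuousAt]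
    intro a
    have hpow : Tendsto (fun b : ℂ => ‖a - b‖ ^ s) (𝓝 a) (𝓝 0) := by
      have : Continuous fun b : ℂ => ‖a - b‖ ^ s :=
        (continuous_const.sub continuous_id).norm.rpow_const fun _ => Or.inr hs.le
      have h := this.tendsto a
      rwa [sub_self, norm_zero, Real.zero_rpow hs.ne'] at h
    refine tendsto_iff_dist_tendsto_zero.2 (squeeze_zero (fun _ => dist_nonneg) (fun b => ?_) hpow)
    rw [Real.dist_eq, ← hN (a - b)]
    refine (abs_sub_map_le_sub N _ _).trans (le_of_eq ?_)
    congr 1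
    rw [map_sub]; ring
  have htop : Tendsto (fun a => N (z - ψ a)) (cocompact ℂ) atTop := by
    refine tendsto_atTop_mono hlow (tendsto_atTop_add_const_right _ _ ?_)
    exact (tendsto_rpow_atTop hs).comp (tendsto_norm_cocompact_atTop)
  obtain ⟨a, ha⟩ := hcont.exists_forall_le htop
  refine ⟨a, ?_⟩
  by_contra hne
  set m := N (z - ψ a) with hm
  have hm0 : 0 < m := lt_of_le_of_ne (apply_nonneg _ _) (Ne.symm hne)
  have hstep : ∀ b w, N (z - ψ b) = m → ‖w‖ ^ s < m → N (z - ψ (b + w)) = m := by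
    intro b w hb hw
    refine le_antisymm ?_ (ha _)
    have hq : ∀ n : ℕ, N (z - ψ (b + w)) ≤ m * (1 + (‖w‖ ^ s / m) ^ (n + 1)) := by
      intro n
      obtain ⟨q, hq⟩ := sub_dvd_pow_sub_pow (X : ℂ[X]) (C w) (n + 1)
      have hmon : (X ^ (n + 1) - C w ^ (n + 1) : ℂ[X]).Monic := by
        rw [← C_pow]; exact monic_X_pow_sub_C _ (Nat.succ_ne_zero n)
      have hdeg : (X ^ (n + 1) - C w ^ (n + 1) : ℂ[X]).natDegree = n + 1 := by
        rw [← C_pow]; exact natDegree_X_pow_sub_C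
      have hqm : q.Monic := (monic_X_sub_C w).of_mul_monic_left (hq ▸ hmon)
      have hqd : q.natDegree = n := by
        rw [hq, (monic_X_sub_C w).natDegree_mul hqm, natDegree_X_sub_C] at hdeg
        omega
      have h1 := pow_natDegree_le_map_eval₂ N ψ hm0.le (x := z - ψ b) (fun c => by
        have := ha (b + c)
        rwa [map_add, ← sub_sub] at this) hqm
      have h2 := congrArg (fun p => N (p.eval₂ ψ (z - ψ b))) hq
      simp only [eval₂_sub, eval₂_mul, eval₂_pow, eval₂_X, eval₂_C, map_mul] at h2
      have h3 : N ((z - ψ b) ^ (n + 1) - ψ w ^ (n + 1)) ≤ m ^ (n + 1) + (‖w‖ ^ s) ^ (n + 1) := by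
        refine (map_sub_le_add N _ _).trans ?_
        rw [map_pow, map_pow, hb, hN]
      rw [map_add, ← sub_sub]
      rw [h2] at h3
      rw [hqd] at h1
      have h4 : N (z - ψ b - ψ w) * m ^ n ≤ m ^ (n + 1) + (‖w‖ ^ s) ^ (n + 1) :=
        (mul_le_mul_of_nonneg_left h1 (apply_nonneg _ _)).trans h3
      have h5 : m * (1 + (‖w‖ ^ s / m) ^ (n + 1)) * m ^ n
          = m ^ (n + 1) + (‖w‖ ^ s) ^ (n + 1) := by
        rw [div_pow]; field_simp; ring
      rw [← h5] at h4
      exact le_of_mul_le_mul_right h4 (by positivity)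
    have hlt : ‖w‖ ^ s / m < 1 := (div_lt_one hm0).2 hw
    have hlim : Tendsto (fun n : ℕ => m * (1 + (‖w‖ ^ s / m) ^ (n + 1))) atTop
        (𝓝 (m * (1 + 0))) :=
      (((tendsto_pow_atTop_nhds_zero_of_lt_one (by positivity) hlt).comp
        (tendsto_add_atTop_nat 1)).const_add 1).const_mul m
    have := ge_of_tendsto' hlim hq
    simpa using this
  set w : ℂ := (((m / 2) ^ s⁻¹ : ℝ) : ℂ) with hw
  have hwn : ‖w‖ ^ s = m / 2 := by
    rw [hw, Complex.norm_real, Real.norm_of_nonneg (by positivity), ← Real.rpow_mul (by positivity),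
      inv_mul_cancel₀ hs.ne', Real.rpow_one]
  have hall : ∀ k : ℕ, N (z - ψ (a + k * w)) = m := by
    intro k
    induction k with
    | zero => simp [hm]
    | succ k ih =>
      have := hstep _ w ih (by rw [hwn]; linarith)
      rwa [show a + ((k + 1 : ℕ) : ℂ) * w = a + k * w + w by push_cast; ring]
  have hw0 : w ≠ 0 := by
    rintro h0
    rw [h0, norm_zero, Real.zero_rpow hs.ne'] at hwn
    linarith
  have ht : Tendsto (fun k : ℕ => a + (k : ℂ) * w) atTop (cocompact ℂ) := by
    rw [← Metric.cobounded_eq_cocompact, ← tendsto_norm_atTop_iff_cobounded]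
    have h1 : Tendsto (fun k : ℕ => (k : ℝ) * ‖w‖ - ‖a‖) atTop atTop :=
      tendsto_atTop_add_const_right _ _
        (tendsto_natCast_atTop_atTop.atTop_mul_const (norm_pos_iff.2 hw0))
    refine tendsto_atTop_mono (fun k => ?_) h1
    have h2 := norm_sub_norm_le ((k : ℂ) * w) (-a)
    rw [norm_mul, Complex.norm_natCast, norm_neg, sub_neg_eq_add, add_comm] at h2
    exact h2
  have := htop.comp ht
  simp only [Function.comp_def, hall] at this
  exact not_tendsto_const_atTop _ _ this

variable {K : Type*} [NontriviallyNormedField K]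

theorem exists_norm_ratCast_eq [CharZero K] (h : ¬ IsUltrametricDist K) :
    ∃ s : ℝ, 0 < s ∧ ∀ q : ℚ, ‖(q : K)‖ = |(q : ℝ)| ^ s := by
  let v : AbsoluteValue ℚ ℝ :=
    { toFun := fun q => ‖(q : K)‖
      map_mul' := fun a b => by simp
      nonneg' := fun a => norm_nonneg _
      eq_zero' := fun a => by simp
      add_le' := fun a b => by push_cast; exact norm_add_le _ _ }
  have hv : ¬ ∀ n : ℕ, v n ≤ 1 := by
    intro hv
    refine h (IsUltrametricDist.isUltrametricDist_of_forall_norm_natCast_le_one fun n => ?_)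
    have : v n = ‖(n : K)‖ := by
      change ‖((n : ℚ) : K)‖ = _
      rw [Rat.cast_natCast]
    exact this ▸ hv n
  obtain ⟨c, hc, hvc⟩ := AbsoluteValue.isEquiv_iff_exists_rpow_eq.1
    (Rat.AbsoluteValue.equiv_real_of_unbounded hv)
  refine ⟨c⁻¹, inv_pos.2 hc, fun q => ?_⟩
  have h1 : ‖(q : K)‖ ^ c = |(q : ℝ)| := by
    have := congrFun hvc q
    rw [Rat.AbsoluteValue.real_eq_abs, Rat.cast_abs] at this
    exact this
  rw [← h1, ← Real.rpow_mul (norm_nonneg _), mul_inv_cancel₀ hc.ne', Real.rpow_one]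

theorem exists_real_ringHom [CharZero K] [CompleteSpace K] {s : ℝ} (hs : 0 < s)
    (h : ∀ q : ℚ, ‖(q : K)‖ = |(q : ℝ)| ^ s) :
    ∃ ρ : ℝ →+* K, ∀ x, ‖ρ x‖ = |x| ^ s := by
  have hui : IsUniformInducing (Rat.castHom ℝ) := Rat.isUniformEmbedding_coe_real.isUniformInducing
  have hdr : DenseRange (Rat.castHom ℝ) := Rat.denseRange_cast
  have huc : UniformContinuous (Rat.castHom K) := by
    rw [Metric.uniformContinuous_iff]
    intro ε hε
    refine ⟨ε ^ s⁻¹, by positivity, fun a b hab => ?_⟩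
    rw [dist_eq_norm]
    simp only [eq_ratCast]
    rw [← Rat.cast_sub, h, Rat.cast_sub, ← Real.dist_eq, Rat.dist_cast]
    calc dist a b ^ s < (ε ^ s⁻¹) ^ s := Real.rpow_lt_rpow dist_nonneg hab hs
      _ = ε := by rw [← Real.rpow_mul hε.le, inv_mul_cancel₀ hs.ne', Real.rpow_one]
  refine ⟨IsDenseInducing.extendRingHom hui hdr huc, fun x => ?_⟩
  have hcont : Continuous (IsDenseInducing.extendRingHom hui hdr huc) :=
    uniformContinuous_uniformly_extend hui hdr huc |>.continuous
  refine Rat.denseRange_cast.induction_on (p := fun x =>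
    ‖IsDenseInducing.extendRingHom hui hdr huc x‖ = |x| ^ s) x
    (isClosed_eq hcont.norm (continuous_abs.rpow_const fun _ => Or.inr hs.le)) fun q => ?_
  rw [← h q, map_ratCast]

theorem norm_eq_one_of_forall_pow_le {x : K} {B : ℝ} (hx : x ≠ 0) (h : ∀ n : ℕ, ‖x‖ ^ n ≤ B)
    (h' : ∀ n : ℕ, ‖x⁻¹‖ ^ n ≤ B) : ‖x‖ = 1 := by
  have key : ∀ r : ℝ, (∀ n : ℕ, r ^ n ≤ B) → r ≤ 1 := by
    intro r hr
    by_contra! h1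
    obtain ⟨n, hn⟩ := pow_unbounded_of_one_lt B h1
    exact absurd (hr n) (not_le.2 hn)
  refine le_antisymm (key _ h) ?_
  have := key _ h'
  rw [norm_inv] at this
  exact (inv_le_one₀ (norm_pos_iff.2 hx)).1 this

/-- Ostrowski's theorem: a complete algebraically closed archimedean field is `ℂ` with a power of
the usual absolute value. -/
theorem exists_complex_ringEquiv [CharZero K] [CompleteSpace K] [IsAlgClosed K]
    (h : ¬ IsUltrametricDist K) :
    ∃ (s : ℝ) (ψ : ℂ ≃+* K), 0 < s ∧ ∀ w, ‖ψ w‖ = ‖w‖ ^ s := by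
  obtain ⟨s, hs, hq⟩ := exists_norm_ratCast_eq h
  obtain ⟨ρ, hρ⟩ := exists_real_ringHom hs hq
  let _ : Algebra ℝ K := ρ.toAlgebra
  obtain ⟨i, hi⟩ := IsAlgClosed.exists_eq_mul_self (-1 : K)
  let ψ : ℂ →ₐ[ℝ] K := Complex.lift ⟨i, hi.symm⟩
  have hψ : ∀ w : ℂ, ψ w = ρ w.re + ρ w.im * i := by
    intro w
    change algebraMap ℝ K w.re + w.im • i = _
    rw [Algebra.smul_def]; rfl
  have hi1 : ‖i‖ = 1 := by
    have := congrArg norm hi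
    rw [norm_neg, norm_one, norm_mul] at this
    nlinarith [norm_nonneg i]
  have hcirc : ∀ w : ℂ, ‖w‖ = 1 → ‖ψ w‖ ≤ 2 := by
    intro w hw
    rw [hψ]
    refine (norm_add_le _ _).trans ?_
    rw [norm_mul, hi1, mul_one, hρ, hρ]
    have h1 : |w.re| ^ s ≤ 1 := Real.rpow_le_one (abs_nonneg _) (hw ▸ Complex.abs_re_le_norm w) hs.le
    have h2 : |w.im| ^ s ≤ 1 := Real.rpow_le_one (abs_nonneg _) (hw ▸ Complex.abs_im_le_norm w) hs.le
    linarith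
  have hcirc1 : ∀ w : ℂ, ‖w‖ = 1 → ‖ψ w‖ = 1 := by
    intro w hw
    have hw0 : w ≠ 0 := by rintro rfl; simp at hw
    refine norm_eq_one_of_forall_pow_le (B := 2) ((map_ne_zero ψ).2 hw0) (fun n => ?_) fun n => ?_
    · rw [← norm_pow, ← map_pow]
      exact hcirc _ (by simp [hw])
    · rw [← norm_pow, ← map_inv₀, ← map_pow]
      exact hcirc _ (by simp [hw])
  have hnorm : ∀ w : ℂ, ‖ψ w‖ = ‖w‖ ^ s := by
    intro w
    rcases eq_or_ne w 0 with rfl | hw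
    · simp [Real.zero_rpow hs.ne']
    have hn : (‖w‖ : ℂ) ≠ 0 := by simpa using hw
    have e : w = (‖w‖ : ℂ) * (w / ‖w‖) := by field_simp
    have h1 : ‖ψ (w / ‖w‖)‖ = 1 := hcirc1 _ (by
      rw [norm_div, Complex.norm_real, norm_norm, div_self (norm_ne_zero_iff.2 hw)])
    have h2 : ‖ψ (‖w‖ : ℂ)‖ = ‖w‖ ^ s := by
      rw [hψ]; simp [hρ]
    conv_lhs => rw [e, map_mul, norm_mul, h1, h2, mul_one]
  have hbij : Function.Bijective (ψ : ℂ →+* K) := by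
    refine ⟨(ψ : ℂ →+* K).injective, fun z => ?_⟩
    let N : MulRingSeminorm K :=
      { toFun := fun x => ‖x‖
        map_zero' := norm_zero
        add_le' := norm_add_le
        neg' := norm_neg
        map_one' := norm_one
        map_mul' := norm_mul }
    obtain ⟨a, ha⟩ := exists_map_sub_eq_zero N (ψ : ℂ →+* K) hs hnorm z
    have ha' : ‖z - ψ a‖ = 0 := ha
    exact ⟨a, (sub_eq_zero.1 (norm_eq_zero.1 ha')).symm⟩
  exact ⟨s, RingEquiv.ofBijective _ hbij, hs, hnorm⟩

/-- Over an archimedean field, every seminorm is the evaluation at a vector. -/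
theorem PreBerk.exists_nrm_eq_norm_eval [CharZero K] [CompleteSpace K] [IsAlgClosed K]
    (h : ¬ IsUltrametricDist K) (x : PreBerk K) :
    ∃ p : Fin 2 → K, p ≠ 0 ∧ ∀ G, x.nrm G = ‖MvPolynomial.eval p G‖ := by
  obtain ⟨s, ψ, hs, hψ⟩ := exists_complex_ringEquiv h
  have hex : ∀ z : MvPolynomial (Fin 2) K, ∃ a : K, x.nrm (z - MvPolynomial.C a) = 0 := by
    intro z
    obtain ⟨a, ha⟩ := exists_map_sub_eq_zero x.nrm (MvPolynomial.C.comp (ψ : ℂ →+* K)) hs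
      (fun w => by simpa [x.map_C] using hψ w) z
    exact ⟨ψ a, by simpa using ha⟩
  choose p hp using fun i : Fin 2 => hex (MvPolynomial.X i)
  have hzero : ∀ G, x.nrm (G - MvPolynomial.C (MvPolynomial.eval p G)) = 0 := by
    intro G
    refine le_antisymm ?_ (apply_nonneg _ _)
    induction G using MvPolynomial.induction_on with
    | C a => simp
    | add G H hG hH =>
      have e : G + H - MvPolynomial.C (MvPolynomial.eval p (G + H)) =
        (G - MvPolynomial.C (MvPolynomial.eval p G)) +
          (H - MvPolynomial.C (MvPolynomial.eval p H)) := by simp only [map_add]; ring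
      rw [e]
      exact (map_add_le_add x.nrm _ _).trans (by linarith)
    | mul_X G i hG =>
      have e : G * MvPolynomial.X i - MvPolynomial.C (MvPolynomial.eval p (G * MvPolynomial.X i)) =
        (G - MvPolynomial.C (MvPolynomial.eval p G)) * MvPolynomial.X i +
          MvPolynomial.C (MvPolynomial.eval p G) * (MvPolynomial.X i - MvPolynomial.C (p i)) := by
        simp only [map_mul, MvPolynomial.eval_X]; ring
      rw [e]
      refine (map_add_le_add x.nrm _ _).trans ?_
      rw [map_mul, map_mul, hp, mul_zero, add_zero, le_antisymm hG (apply_nonneg _ _), zero_mul]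
  have hval : ∀ G, x.nrm G = ‖MvPolynomial.eval p G‖ := by
    intro G
    rw [← x.map_C]
    have h1 := abs_sub_map_le_sub x.nrm G (MvPolynomial.C (MvPolynomial.eval p G))
    rw [hzero] at h1
    exact sub_eq_zero.1 (abs_eq_zero.1 (le_antisymm h1 (abs_nonneg _)))
  refine ⟨p, ?_, hval⟩
  rintro rfl
  obtain ⟨i, hi⟩ := x.ne_zero
  exact hi (by rw [hval]; simp)

end Archimedean

section Wedge

/-- The determinant of two vectors of `K²`. -/
def wedge {R : Type*} [CommRing R] (p q : Fin 2 → R) : R := p 0 * q 1 - p 1 * q 0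

theorem wedge_comm {R : Type*} [CommRing R] (p q : Fin 2 → R) : wedge p q = -wedge q p := by
  simp only [wedge]; ring

@[simp] theorem wedge_self {R : Type*} [CommRing R] (p : Fin 2 → R) : wedge p p = 0 := by
  simp only [wedge]; ring

theorem wedge_smul_left {R : Type*} [CommRing R] (a : R) (p q : Fin 2 → R) :
    wedge (a • p) q = a * wedge p q := by
  simp only [wedge, Pi.smul_apply, smul_eq_mul]; ring

theorem wedge_smul_eq {R : Type*} [CommRing R] (p q r : Fin 2 → R) :
    wedge p r • q = wedge p q • r + wedge q r • p := by
  ext i; fin_cases i <;> simp [wedge] <;> ring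

theorem mk_eq_mk_iff_wedge {K : Type*} [Field K] {p q : Fin 2 → K} (hp : p ≠ 0) (hq : q ≠ 0) :
    Projectivization.mk K p hp = Projectivization.mk K q hq ↔ wedge p q = 0 := by
  rw [Projectivization.mk_eq_mk_iff']
  constructor
  · rintro ⟨a, rfl⟩
    rw [wedge_smul_left, wedge_self, mul_zero]
  · intro h
    obtain ⟨i, hi⟩ : ∃ i, q i ≠ 0 := by
      by_contra! h'; exact hq (funext h')
    refine ⟨p i / q i, ?_⟩
    ext j
    have h' : p 0 * q 1 = p 1 * q 0 := sub_eq_zero.1 h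
    rw [Pi.smul_apply, smul_eq_mul]
    fin_cases i <;> fin_cases j <;> simp at hi ⊢ <;> field_simp <;> grind

variable {K : Type*} [NontriviallyNormedField K]

theorem norm_wedge_le (p q : Fin 2 → K) : ‖wedge p q‖ ≤ 2 * (‖p‖ * ‖q‖) := by
  have h1 : ‖p 0 * q 1‖ ≤ ‖p‖ * ‖q‖ := by
    rw [norm_mul]; gcongr <;> exact norm_le_pi_norm _ _
  have h2 : ‖p 1 * q 0‖ ≤ ‖p‖ * ‖q‖ := by
    rw [norm_mul]; gcongr <;> exact norm_le_pi_norm _ _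
  exact (norm_sub_le _ _).trans (by linarith)

/-- The chordal metric with respect to the maximum norm, in homogeneous coordinates. -/
def vdist (p q : Fin 2 → K) : ℝ := ‖wedge p q‖ / (‖p‖ * ‖q‖)

theorem vdist_nonneg (p q : Fin 2 → K) : 0 ≤ vdist p q := by unfold vdist; positivity

theorem vdist_comm (p q : Fin 2 → K) : vdist p q = vdist q p := by
  rw [vdist, vdist, wedge_comm, norm_neg, mul_comm ‖p‖]

theorem vdist_smul_left {a : K} (ha : a ≠ 0) (p q : Fin 2 → K) : vdist (a • p) q = vdist p q := by
  rw [vdist, vdist, wedge_smul_left, norm_mul, norm_smul, mul_assoc,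
    mul_div_mul_left _ _ (norm_ne_zero_iff.2 ha)]

theorem vdist_smul_right {a : K} (ha : a ≠ 0) (p q : Fin 2 → K) :
    vdist p (a • q) = vdist p q := by
  rw [vdist_comm, vdist_smul_left ha, vdist_comm]

theorem vdist_triangle {p q r : Fin 2 → K} (hp : p ≠ 0) (hq : q ≠ 0) (hr : r ≠ 0) :
    vdist p r ≤ vdist p q + vdist q r := by
  have hp' := norm_pos_iff.2 hp
  have hq' := norm_pos_iff.2 hq
  have hr' := norm_pos_iff.2 hr
  have h := norm_add_le (wedge p q • r) (wedge q r • p)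
  rw [← wedge_smul_eq, norm_smul, norm_smul, norm_smul] at h
  have e : vdist p q + vdist q r =
      (‖wedge p q‖ * ‖r‖ + ‖wedge q r‖ * ‖p‖) / (‖p‖ * ‖q‖ * ‖r‖) := by
    unfold vdist; field_simp
  have e' : vdist p r = ‖wedge p r‖ * ‖q‖ / (‖p‖ * ‖q‖ * ‖r‖) := by
    unfold vdist; field_simp
  rw [e, e']
  gcongr

theorem vdist_eq_zero_iff {p q : Fin 2 → K} (hp : p ≠ 0) (hq : q ≠ 0) :
    vdist p q = 0 ↔ wedge p q = 0 := by
  have hp' := norm_pos_iff.2 hp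
  have hq' := norm_pos_iff.2 hq
  rw [vdist, div_eq_zero_iff, norm_eq_zero]
  simp [hp, hq]

theorem norm_vec_eq (p : Fin 2 → K) : ‖p‖ = max ‖p 0‖ ‖p 1‖ := by
  refine le_antisymm ((pi_norm_le_iff_of_nonneg (by positivity)).2 fun i => ?_)
    (max_le (norm_le_pi_norm p 0) (norm_le_pi_norm p 1))
  fin_cases i
  · exact le_max_left _ _
  · exact le_max_right _ _

theorem norm_le_vecNorm (p : Fin 2 → K) : ‖p‖ ≤ vecNorm p := by
  rw [norm_vec_eq, vecNorm]
  split_ifs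
  · exact le_rfl
  · exact max_le (Real.le_sqrt_of_sq_le (by nlinarith [sq_nonneg ‖p 1‖]))
      (Real.le_sqrt_of_sq_le (by nlinarith [sq_nonneg ‖p 0‖]))

theorem vecNorm_le (p : Fin 2 → K) : vecNorm p ≤ 2 * ‖p‖ := by
  have h0 := norm_le_pi_norm p 0
  have h1 := norm_le_pi_norm p 1
  rw [vecNorm]
  split_ifs
  · exact max_le (by linarith [norm_nonneg p]) (by linarith [norm_nonneg p])
  · rw [Real.sqrt_le_left (by positivity)]
    nlinarith [norm_nonneg (p 0), norm_nonneg (p 1)]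

theorem vdist_rep_le (z w : P1 K) : vdist z.rep w.rep ≤ 4 * chordal z w := by
  have hz := norm_pos_iff.2 z.rep_nonzero
  have hw := norm_pos_iff.2 w.rep_nonzero
  have hz' := hz.trans_le (norm_le_vecNorm _)
  have hw' := hw.trans_le (norm_le_vecNorm _)
  change ‖wedge z.rep w.rep‖ / (‖z.rep‖ * ‖w.rep‖) ≤
    4 * (‖wedge z.rep w.rep‖ / (vecNorm z.rep * vecNorm w.rep))
  rw [← mul_div_assoc, div_le_div_iff₀ (by positivity) (by positivity)]
  have : vecNorm z.rep * vecNorm w.rep ≤ (2 * ‖z.rep‖) * (2 * ‖w.rep‖) := by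
    gcongr <;> exact vecNorm_le _
  nlinarith [norm_nonneg (wedge z.rep w.rep)]

theorem chordal_le_two (z w : P1 K) : chordal z w ≤ 2 := by
  have hz := norm_pos_iff.2 z.rep_nonzero
  have hw := norm_pos_iff.2 w.rep_nonzero
  have hz' := hz.trans_le (norm_le_vecNorm _)
  have hw' := hw.trans_le (norm_le_vecNorm _)
  change ‖wedge z.rep w.rep‖ / (vecNorm z.rep * vecNorm w.rep) ≤ 2
  rw [div_le_iff₀ (by positivity)]
  refine (norm_wedge_le _ _).trans ?_
  gcongr <;> exact norm_le_vecNorm _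

theorem vdist_rep_mk {p q : Fin 2 → K} (hp : p ≠ 0) (hq : q ≠ 0) :
    vdist (Projectivization.mk K p hp).rep (Projectivization.mk K q hq).rep = vdist p q := by
  obtain ⟨a, ha⟩ := Projectivization.exists_smul_eq_mk_rep K p hp
  obtain ⟨b, hb⟩ := Projectivization.exists_smul_eq_mk_rep K q hq
  rw [← ha, ← hb, Units.smul_def, Units.smul_def, vdist_smul_left a.ne_zero,
    vdist_smul_right b.ne_zero]

end Wedge

section LinearForms

open MvPolynomial

variable {K : Type*} [Field K]

/-- The linear form vanishing at `p`. -/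
def lform (p : Fin 2 → K) : MvPolynomial (Fin 2) K := C (p 0) * X 1 - C (p 1) * X 0

theorem lform_isHomogeneous (p : Fin 2 → K) : (lform p).IsHomogeneous 1 :=
  ((isHomogeneous_X K 1).C_mul _).sub ((isHomogeneous_X K 0).C_mul _)

@[simp] theorem eval_lform (p q : Fin 2 → K) : eval q (lform p) = wedge p q := by
  simp [lform, wedge]

theorem homogenize_prod_X_sub_C (S : Multiset K) :
    ((S.map fun a => Polynomial.X - Polynomial.C a).prod).homogenize S.card =
      (S.map fun a => lform ![-a, -1]).prod := by
  induction S using Multiset.induction_on with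
  | empty => simp
  | cons a S ih =>
    rw [Multiset.map_cons, Multiset.prod_cons, Multiset.card_cons, add_comm,
      Polynomial.homogenize_mul _ _ (by simp) (by simp), ih,
      Multiset.map_cons, Multiset.prod_cons]
    congr 1
    rw [Polynomial.homogenize_sub, Polynomial.homogenize_X one_ne_zero, Polynomial.homogenize_C]
    simp [lform]; ring

theorem natDegree_aeval_le_of_isHomogeneous {G : MvPolynomial (Fin 2) K} {n : ℕ}
    (hG : G.IsHomogeneous n) :
    (aeval (![Polynomial.X, 1] : Fin 2 → Polynomial K) G).natDegree ≤ n := by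
  rw [G.as_sum, map_sum]
  refine Polynomial.natDegree_sum_le_of_forall_le _ _ fun m hm => ?_
  have hdeg : m 0 + m 1 = n := by
    have := hG (mem_support_iff.1 hm)
    simpa [Finsupp.weight_apply, Finsupp.sum_fintype, Fin.sum_univ_two] using this
  rw [aeval_monomial, Finsupp.prod_fintype _ _ (by simp), Fin.prod_univ_two]
  simp only [Matrix.cons_val_zero, Matrix.cons_val_one, one_pow, mul_one]
  refine (Polynomial.natDegree_C_mul_X_pow_le _ _).trans (by omega)

theorem eval_smul_of_isHomogeneous {G : MvPolynomial (Fin 2) K} {n : ℕ}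
    (hG : G.IsHomogeneous n) (a : K) (p : Fin 2 → K) : eval (a • p) G = a ^ n * eval p G := by
  rw [eval_eq', eval_eq', Finset.mul_sum]
  refine Finset.sum_congr rfl fun m hm => ?_
  have hdeg : m 0 + m 1 = n := by
    have := hG (mem_support_iff.1 hm)
    simpa [Finsupp.weight_apply, Finsupp.sum_fintype, Fin.sum_univ_two] using this
  rw [Fin.prod_univ_two, Fin.prod_univ_two, ← hdeg]
  simp only [Pi.smul_apply, smul_eq_mul]
  ring

/-- Over an algebraically closed field, a binary form is a product of linear forms. -/
theorem exists_eq_prod_lform [IsAlgClosed K] {G : MvPolynomial (Fin 2) K} {n : ℕ}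
    (hG : G.IsHomogeneous n) :
    ∃ (a : K) (S : Multiset (Fin 2 → K)), S.card = n ∧ (∀ p ∈ S, p ≠ 0) ∧
      G = C a * (S.map lform).prod := by
  have hX : (X 1 : MvPolynomial (Fin 2) K) = lform ![1, 0] := by simp [lform]
  have h10 : (![1, 0] : Fin 2 → K) ≠ 0 := fun h => by simpa using congrFun h 0
  set g := aeval (![Polynomial.X, 1] : Fin 2 → Polynomial K) G with hg
  have hGg : g.homogenize n = G := Polynomial.homogenize_eq_of_isHomogeneous hG hg.symm
  rcases eq_or_ne g 0 with h0 | h0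
  · refine ⟨0, Multiset.replicate n ![1, 0], by simp, fun p hp => ?_, ?_⟩
    · rw [Multiset.eq_of_mem_replicate hp]; exact h10
    · rw [← hGg, h0]; simp
  have hs := IsAlgClosed.splits g
  have hn : g.natDegree ≤ n := natDegree_aeval_le_of_isHomogeneous hG
  have hcard : g.natDegree = g.roots.card := hs.natDegree_eq_card_roots
  refine ⟨g.leadingCoeff, g.roots.map (fun a => ![-a, -1]) +
    Multiset.replicate (n - g.natDegree) ![1, 0], ?_, ?_, ?_⟩
  · rw [Multiset.card_add, Multiset.card_map, Multiset.card_replicate, ← hcard]; omega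
  · intro p hp
    rcases Multiset.mem_add.1 hp with h | h
    · obtain ⟨a, -, rfl⟩ := Multiset.mem_map.1 h
      exact fun h => by simpa using congrFun h 1
    · rw [Multiset.eq_of_mem_replicate h]; exact h10
  · have h1 := hs.eq_prod_roots
    have h2 := Polynomial.homogenize_mul (g.roots.map fun a => Polynomial.X - Polynomial.C a).prod
      1 (m := g.roots.card) (n := n - g.natDegree) (by simp) (by simp)
    rw [homogenize_prod_X_sub_C, mul_one, ← hcard, Nat.add_sub_cancel' hn,
      Polynomial.homogenize_one] at h2
    rw [← hGg]
    conv_lhs => rw [h1, Polynomial.homogenize_C_mul, h2]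
    simp [Multiset.map_map, hX]

end LinearForms

section Vectors

open MvPolynomial

variable {K : Type*} [NontriviallyNormedField K]

theorem ofP1_mk (p : Fin 2 → K) (hp : p ≠ 0) :
    BerkP1.ofP1 (Projectivization.mk K p hp) =
      Quotient.mk (PreBerk.setoid K) (PreBerk.ofVec p hp) := by
  obtain ⟨a, ha⟩ := Projectivization.exists_smul_eq_mk_rep K p hp
  refine Quotient.sound ⟨‖(a : K)‖, norm_pos_iff.2 a.ne_zero, fun n G hG => ?_⟩
  change ‖eval _ G‖ = ‖(a : K)‖ ^ n * ‖eval p G‖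
  rw [← ha, Units.smul_def]
  rw [eval_smul_of_isHomogeneous hG, norm_mul, norm_pow]

/-- The homogeneous lift of `f` as a self-map of `K²`. -/
def liftVec (f : RatFunc K) (p : Fin 2 → K) : Fin 2 → K := fun i => eval p (homLift f i)

theorem liftVec_ne_zero (f : RatFunc K) {p : Fin 2 → K} (hp : p ≠ 0) : liftVec f p ≠ 0 := by
  obtain ⟨i, hi⟩ := homLift_ne_zero f (PreBerk.ofVec p hp)
  intro h
  apply hi
  change ‖eval p (homLift f i)‖ = 0
  rw [norm_eq_zero]
  exact congrFun h i

theorem iterate_liftVec_ne_zero (f : RatFunc K) {p : Fin 2 → K} (hp : p ≠ 0) (n : ℕ) :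
    (liftVec f)^[n] p ≠ 0 := by
  induction n with
  | zero => exact hp
  | succ n ih => rw [Function.iterate_succ_apply']; exact liftVec_ne_zero f ih

theorem liftVec_smul (f : RatFunc K) (a : K) (p : Fin 2 → K) :
    liftVec f (a • p) = a ^ ratDegree f • liftVec f p := by
  ext i
  exact eval_smul_of_isHomogeneous (homLift_isHomogeneous f i) a p

theorem ratMap_mk (f : RatFunc K) (p : Fin 2 → K) (hp : p ≠ 0) :
    ratMap f (Projectivization.mk K p hp) =
      Projectivization.mk K (liftVec f p) (liftVec_ne_zero f hp) := by
  obtain ⟨a, ha⟩ := Projectivization.exists_smul_eq_mk_rep K p hp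
  refine (mk_eq_mk_iff_wedge (liftVec_ne_zero f (Projectivization.rep_nonzero _)) _).2 ?_
  rw [← ha, Units.smul_def, liftVec_smul, wedge_smul_left, wedge_self, mul_zero]

theorem iterate_ratMap_mk (f : RatFunc K) (p : Fin 2 → K) (hp : p ≠ 0) (n : ℕ) :
    (ratMap f)^[n] (Projectivization.mk K p hp) =
      Projectivization.mk K ((liftVec f)^[n] p) (iterate_liftVec_ne_zero f hp n) := by
  induction n with
  | zero => rfl
  | succ n ih =>
    rw [Function.iterate_succ_apply', ih, ratMap_mk]
    simp only [Function.iterate_succ_apply']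

theorem map_ofP1 (f : RatFunc K) (z : P1 K) :
    BerkP1.map f (BerkP1.ofP1 z) = BerkP1.ofP1 (ratMap f z) := by
  rw [← z.mk_rep, ratMap_mk, ofP1_mk, ofP1_mk]
  refine Quotient.sound ⟨1, one_pos, fun n G _ => ?_⟩
  change ‖eval z.rep (aeval (homLift f) G)‖ = 1 ^ n * ‖eval (liftVec f z.rep) G‖
  rw [one_pow, one_mul, map_aeval, MvPolynomial.coe_eval₂Hom, algebraMap_eq]
  congr 1
  have : (eval z.rep).comp C = RingHom.id K := by ext; simp
  rw [this]; rfl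

theorem iterate_map_ofP1 (f : RatFunc K) (z : P1 K) (n : ℕ) :
    (BerkP1.map f)^[n] (BerkP1.ofP1 z) = BerkP1.ofP1 ((ratMap f)^[n] z) :=
  (Function.Semiconj.iterate_right (fun z => (map_ofP1 f z).symm) n z).symm

/-- The iterates of the lift of `f` along a polynomial curve in `K²`. -/
def liftPoly (f : RatFunc K) (N : Fin 2 → Polynomial K) : Fin 2 → Polynomial K :=
  fun i => aeval N (homLift f i)

theorem eval_liftPoly (f : RatFunc K) (N : Fin 2 → Polynomial K) (t : K) :
    (fun i => (liftPoly f N i).eval t) = liftVec f (fun i => (N i).eval t) := by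
  ext i
  rw [liftPoly, ← Polynomial.coe_evalRingHom, map_aeval, MvPolynomial.coe_eval₂Hom]
  have : (Polynomial.evalRingHom t).comp (algebraMap K (Polynomial K)) = RingHom.id K := by
    ext; simp
  rw [this]; rfl

theorem eval_iterate_liftPoly (f : RatFunc K) (N : Fin 2 → Polynomial K) (t : K) (n : ℕ) :
    (fun i => ((liftPoly f)^[n] N i).eval t) = (liftVec f)^[n] (fun i => (N i).eval t) := by
  induction n with
  | zero => rfl
  | succ n ih => rw [Function.iterate_succ_apply', eval_liftPoly, ih, Function.iterate_succ_apply']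

theorem derivative_aeval (N : Fin 2 → Polynomial K) (G : MvPolynomial (Fin 2) K) :
    (aeval N G).derivative = ∑ k, aeval N (pderiv k G) * (N k).derivative := by
  induction G using MvPolynomial.induction_on with
  | C a => simp
  | add G H hG hH => simp only [map_add, hG, hH, add_mul, Finset.sum_add_distrib]
  | mul_X G i hG =>
    simp only [map_mul, Polynomial.derivative_mul, hG, aeval_X, Derivation.leibniz, pderiv_X,
      smul_eq_mul, map_add, Fin.sum_univ_two]
    fin_cases i <;> simp <;> ring

/-- The Wronskian at `t` of a polynomial curve in `K²`. -/
def wronAt (N : Fin 2 → Polynomial K) (t : K) : K :=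
  wedge (fun i => (N i).derivative.eval t) (fun i => (N i).eval t)

theorem wronAt_liftPoly (f : RatFunc K) {N : Fin 2 → Polynomial K} {t : K}
    (hN : (fun i => (N i).eval t) ≠ 0) (h : wronAt N t = 0) : wronAt (liftPoly f N) t = 0 := by
  obtain ⟨i, hi⟩ : ∃ i, (N i).eval t ≠ 0 := by
    by_contra! h'; exact hN (funext h')
  set v : Fin 2 → K := fun i => (N i).eval t with hv
  set l : K := (N i).derivative.eval t / (N i).eval t with hl
  have hder : ∀ k, (N k).derivative.eval t = l * (N k).eval t := by
    intro k
    have h' : (N 0).derivative.eval t * (N 1).eval t = (N 1).derivative.eval t * (N 0).eval t :=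
      sub_eq_zero.1 h
    rw [hl]
    fin_cases i <;> fin_cases k <;> simp at hi ⊢ <;> field_simp <;> grind
  have hlift : ∀ k, (liftPoly f N k).derivative.eval t =
      (l * ratDegree f) * (liftPoly f N k).eval t := by
    intro k
    have euler := congrArg (fun G => (aeval N G).eval t)
      (homLift_isHomogeneous f k).sum_X_mul_pderiv
    rw [liftPoly, derivative_aeval]
    simp only [Fin.sum_univ_two, map_add, map_mul, aeval_X, Polynomial.eval_add,
      Polynomial.eval_mul, nsmul_eq_mul, map_natCast, Polynomial.eval_natCast] at euler ⊢
    rw [hder, hder]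
    linear_combination l * euler
  simp only [wronAt, wedge, hlift]
  ring

theorem wronAt_iterate_liftPoly (f : RatFunc K) {N : Fin 2 → Polynomial K} {t : K}
    (hN : (fun i => (N i).eval t) ≠ 0) (h : wronAt (liftPoly f N) t = 0) {n : ℕ} (hn : 1 ≤ n) :
    wronAt ((liftPoly f)^[n] N) t = 0 := by
  induction n, hn using Nat.le_induction with
  | base => exact h
  | succ n hn ih =>
    rw [Function.iterate_succ_apply']
    refine wronAt_liftPoly f ?_ ih
    rw [eval_iterate_liftPoly]
    exact iterate_liftVec_ne_zero f hN n

end Vectors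

section CriticalPoints

variable {K : Type*} [NontriviallyNormedField K]

theorem coord_mk (j : Fin 2) (p : Fin 2 → K) (hp : p ≠ 0) :
    coord j (Projectivization.mk K p hp) = p (j + 1) / p j := by
  obtain ⟨a, ha⟩ := Projectivization.exists_smul_eq_mk_rep K p hp
  rw [coord, ← ha, Units.smul_def, Pi.smul_apply, Pi.smul_apply, smul_eq_mul, smul_eq_mul,
    mul_div_mul_left _ _ a.ne_zero]

theorem rep_mk_ne_zero_iff (j : Fin 2) (p : Fin 2 → K) (hp : p ≠ 0) :
    (Projectivization.mk K p hp).rep j ≠ 0 ↔ p j ≠ 0 := by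
  obtain ⟨a, ha⟩ := Projectivization.exists_smul_eq_mk_rep K p hp
  rw [← ha, Units.smul_def, Pi.smul_apply, smul_eq_mul]
  simp

/-- The standard chart `i` as a polynomial curve in `K²`, centred at the parameter `t₀`. -/
def chartPoly (i : Fin 2) (t₀ : K) : Fin 2 → Polynomial K :=
  fun j => if j = i then 1 else Polynomial.X + Polynomial.C t₀

/-- The vector with coordinate `t` in the standard chart `i`. -/
def chartVec (i : Fin 2) (t : K) : Fin 2 → K := fun j => if j = i then 1 else t

theorem chartVec_ne_zero (i : Fin 2) (t : K) : chartVec i t ≠ 0 :=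
  fun h => one_ne_zero (α := K) (by simpa [chartVec] using congrFun h i)

theorem eval_chartPoly (i : Fin 2) (t₀ t : K) :
    (fun j => (chartPoly i t₀ j).eval t) = chartVec i (t + t₀) := by
  ext j; by_cases h : j = i <;> simp [chartPoly, chartVec, h]

theorem mk_chartVec_coord {i : Fin 2} {c : P1 K} (hc : c.rep i ≠ 0) :
    Projectivization.mk K (chartVec i (coord i c)) (chartVec_ne_zero _ _) = c := by
  conv_rhs => rw [← c.mk_rep]
  rw [mk_eq_mk_iff_wedge]
  fin_cases i <;> simp [chartVec, coord, wedge] at hc ⊢ <;> field_simp <;> ring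

theorem hasDerivAt_coord_iff_wronAt (f : RatFunc K) (n : ℕ) (i j : Fin 2) (t₀ : K)
    (hj : (liftVec f)^[n] (chartVec i t₀) j ≠ 0) :
    HasDerivAt (fun t : K => coord j ((ratMap f)^[n] (ofCoord i t))) 0 t₀ ↔
      wronAt ((liftPoly f)^[n] (chartPoly i t₀)) 0 = 0 := by
  set N := (liftPoly f)^[n] (chartPoly i t₀) with hN
  have heval : ∀ t, (fun k => (N k).eval t) = (liftVec f)^[n] (chartVec i (t + t₀)) := fun t => by
    rw [hN, eval_iterate_liftPoly, eval_chartPoly]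
  have hfun : (fun t : K => coord j ((ratMap f)^[n] (ofCoord i t))) =
      fun t => (N (j + 1)).eval (t - t₀) / (N j).eval (t - t₀) := by
    ext t
    have h1 : ofCoord i t = Projectivization.mk K (chartVec i t) (chartVec_ne_zero i t) := rfl
    have h2 := heval (t - t₀)
    rw [sub_add_cancel] at h2
    rw [h1, iterate_ratMap_mk, coord_mk, ← h2]
  have hj' : (N j).eval 0 ≠ 0 := by
    have := congrFun (heval 0) j
    rw [zero_add] at this
    rwa [this]
  have hd : ∀ k, HasDerivAt (fun t => (N k).eval (t - t₀)) ((N k).derivative.eval 0) t₀ := by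
    intro k
    have h1 := (N k).hasDerivAt (t₀ - t₀)
    rw [sub_self] at h1
    have h2 := HasDerivAt.comp_sub_const t₀ t₀ (f := fun t => (N k).eval t)
      (by rw [sub_self]; exact h1)
    exact h2
  have hder := (hd (j + 1)).div (hd j) (by rwa [sub_self])
  rw [sub_self] at hder
  have hiff : ((N (j + 1)).derivative.eval 0 * (N j).eval 0 -
      (N (j + 1)).eval 0 * (N j).derivative.eval 0) / (N j).eval 0 ^ 2 = 0 ↔ wronAt N 0 = 0 := by
    rw [div_eq_zero_iff, or_iff_left (pow_ne_zero 2 hj')]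
    simp only [wronAt, wedge]
    fin_cases j
    · simp only [Fin.zero_eta, zero_add, Fin.isValue]
      constructor <;> intro h <;> linear_combination -h
    · have : (1 + 1 : Fin 2) = 0 := rfl
      simp only [Fin.mk_one, this, Fin.isValue]
      constructor <;> intro h <;> linear_combination h
  rw [hfun, ← hiff]
  constructor
  · intro h
    exact (h.unique hder).symm
  · intro h
    rw [← h]
    exact hder

theorem wronAt_of_mem_critSet {f : RatFunc K} {c : P1 K} (hc : c ∈ critSet (ratMap f)) :
    ∃ (i : Fin 2) (t₀ : K), c = Projectivization.mk K (chartVec i t₀) (chartVec_ne_zero i t₀) ∧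
      ∀ n, 1 ≤ n → wronAt ((liftPoly f)^[n] (chartPoly i t₀)) 0 = 0 := by
  obtain ⟨i, j, hi, hj, hd⟩ := hc
  have hmk := mk_chartVec_coord hi
  refine ⟨i, coord i c, hmk.symm, fun n hn => wronAt_iterate_liftPoly f ?_ ?_ hn⟩
  · rw [eval_chartPoly]; exact chartVec_ne_zero _ _
  · refine (hasDerivAt_coord_iff_wronAt f 1 i j (coord i c) ?_).1 hd
    rw [← hmk, ratMap_mk, rep_mk_ne_zero_iff] at hj
    exact hj

theorem mem_superattracting_of_periodic {f : RatFunc K} {c : P1 K} (hc : c ∈ critSet (ratMap f))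
    {n : ℕ} (hn : 1 ≤ n) (hper : (ratMap f)^[n] c = c) : c ∈ superattracting f := by
  refine ⟨n, hn, hper, ?_⟩
  obtain ⟨i, t₀, rfl, hw⟩ := wronAt_of_mem_critSet hc
  obtain ⟨j, hj⟩ : ∃ j, (liftVec f)^[n] (chartVec i t₀) j ≠ 0 := by
    by_contra! h'
    exact iterate_liftVec_ne_zero f (chartVec_ne_zero i t₀) n (funext h')
  have hcoord : coord i (Projectivization.mk K (chartVec i t₀) (chartVec_ne_zero i t₀)) = t₀ := by
    rw [coord_mk]
    fin_cases i <;> simp [chartVec]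
  refine ⟨i, j, ?_, ?_, ?_⟩
  · rw [rep_mk_ne_zero_iff]; simp [chartVec]
  · rw [iterate_ratMap_mk, rep_mk_ne_zero_iff]; exact hj
  · rw [hcoord]
    exact (hasDerivAt_coord_iff_wronAt f n i j t₀ hj).2 (hw n hn)

end CriticalPoints

section Topology

open MvPolynomial

variable {K : Type*} [NontriviallyNormedField K]

theorem PreBerk.max_nrm_pos (x : PreBerk K) : 0 < max (x.nrm (X 0)) (x.nrm (X 1)) := by
  obtain ⟨i, hi⟩ := x.ne_zero
  have hpos : 0 < x.nrm (X i) := lt_of_le_of_ne (apply_nonneg _ _) (Ne.symm hi)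
  fin_cases i
  · exact hpos.trans_le (le_max_left _ _)
  · exact hpos.trans_le (le_max_right _ _)

theorem exists_eval_eq_zero [IsAlgClosed K] {G : MvPolynomial (Fin 2) K} {n : ℕ} (hn : 1 ≤ n)
    (hG : G.IsHomogeneous n) : ∃ p : Fin 2 → K, p ≠ 0 ∧ eval p G = 0 := by
  obtain ⟨a, S, hS, hne, rfl⟩ := exists_eq_prod_lform hG
  obtain ⟨q, hq⟩ := Multiset.card_pos_iff_exists_mem.1 (hS ▸ hn)
  refine ⟨q, hne q hq, ?_⟩
  rw [map_mul, map_multiset_prod, Multiset.map_map, Multiset.prod_eq_zero, mul_zero]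
  exact Multiset.mem_map.2 ⟨q, hq, by simp⟩

theorem ratMap_surjective [IsAlgClosed K] {f : RatFunc K} (hf : 1 ≤ ratDegree f) :
    Function.Surjective (ratMap f) := by
  intro z
  obtain ⟨p, hp, hp0⟩ := exists_eval_eq_zero (by rwa [mul_one])
    ((lform_isHomogeneous z.rep).aeval _ (homLift_isHomogeneous f))
  refine ⟨Projectivization.mk K p hp, ?_⟩
  rw [ratMap_mk]
  conv_rhs => rw [← z.mk_rep]
  rw [mk_eq_mk_iff_wedge, wedge_comm, neg_eq_zero]
  simpa [lform, wedge, liftVec] using hp0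

namespace BerkP1

theorem continuous_normVal (n : ℕ) (G : homogeneousSubmodule (Fin 2) K n) :
    Continuous (normVal n G) :=
  continuous_iff_le_induced.2 ((iInf_le _ n).trans (iInf_le _ G))

theorem tendsto_nhds_iff {α : Type*} {l : Filter α} {g : α → BerkP1 K} {x : BerkP1 K} :
    Tendsto g l (𝓝 x) ↔ ∀ (n : ℕ) (G : homogeneousSubmodule (Fin 2) K n),
      Tendsto (fun a => normVal n G (g a)) l (𝓝 (normVal n G x)) := by
  refine ⟨fun h n G => ((continuous_normVal n G).tendsto x).comp h, fun h => ?_⟩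
  simp only [nhds_iInf, nhds_induced, tendsto_iInf, tendsto_comap_iff]
  exact h

theorem eq_of_normVal_eq {x y : BerkP1 K}
    (h : ∀ (n : ℕ) (G : homogeneousSubmodule (Fin 2) K n), normVal n G x = normVal n G y) :
    x = y := by
  induction x using Quotient.inductionOn with | h x => ?_
  induction y using Quotient.inductionOn with | h y => ?_
  have hx := x.max_nrm_pos
  have hy := y.max_nrm_pos
  refine Quotient.sound ⟨max (x.nrm (X 0)) (x.nrm (X 1)) / max (y.nrm (X 0)) (y.nrm (X 1)),
    by positivity, fun n G hG => ?_⟩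
  have := h n ⟨G, hG⟩
  change x.nrm G / _ ^ n = y.nrm G / _ ^ n at this
  rw [div_eq_div_iff (by positivity) (by positivity)] at this
  rw [div_pow]
  field_simp
  linarith

instance : RegularSpace (BerkP1 K) :=
  regularSpace_iInf fun n => regularSpace_iInf fun G => regularSpace_induced (normVal n G)

instance : T0Space (BerkP1 K) := by
  rw [t0Space_iff_inseparable]
  exact fun x y h => eq_of_normVal_eq fun n G => (h.map (continuous_normVal n G)).eq

theorem continuous_map (f : RatFunc K) : Continuous (map f) := by
  rw [continuous_iff_continuousAt]
  intro x
  refine tendsto_nhds_iff.2 fun n G => ?_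
  have hG : (G : MvPolynomial (Fin 2) K).IsHomogeneous n :=
    (mem_homogeneousSubmodule n _).mp G.2
  let GF : homogeneousSubmodule (Fin 2) K (ratDegree f * n) :=
    ⟨aeval (homLift f) (G : MvPolynomial (Fin 2) K), hG.aeval _ (homLift_isHomogeneous f)⟩
  let F : Fin 2 → homogeneousSubmodule (Fin 2) K (ratDegree f) :=
    fun i => ⟨homLift f i, homLift_isHomogeneous f i⟩
  have key : ∀ y, normVal n G (map f y) =
      normVal _ GF y / max (normVal _ (F 0) y) (normVal _ (F 1) y) ^ n := by
    intro y
    induction y using Quotient.inductionOn with | h y => ?_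
    have hy := y.max_nrm_pos
    set M := max (y.nrm (X 0)) (y.nrm (X 1)) with hM
    change y.nrm (aeval (homLift f) (G : MvPolynomial (Fin 2) K)) /
        max (y.nrm (aeval (homLift f) (X 0))) (y.nrm (aeval (homLift f) (X 1))) ^ n =
      (y.nrm (aeval (homLift f) (G : MvPolynomial (Fin 2) K)) / M ^ (ratDegree f * n)) /
        max (y.nrm (homLift f 0) / M ^ ratDegree f) (y.nrm (homLift f 1) / M ^ ratDegree f) ^ n
    rw [aeval_X, aeval_X, max_div_div_right (by positivity : 0 ≤ M ^ ratDegree f), div_pow,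
      ← pow_mul, div_div_div_cancel_right₀ (by positivity)]
  have hne : max (normVal _ (F 0) x) (normVal _ (F 1) x) ^ n ≠ 0 := by
    refine pow_ne_zero _ (ne_of_gt ?_)
    induction x using Quotient.inductionOn with | h x => ?_
    have hx := x.max_nrm_pos
    have hpos : ∀ i, x.nrm (homLift f i) ≠ 0 → 0 < normVal _ (F i) (Quotient.mk _ x) := fun i hi =>
      div_pos (lt_of_le_of_ne (apply_nonneg _ _) (Ne.symm hi)) (by positivity)
    obtain ⟨i, hi⟩ := homLift_ne_zero f x
    have := hpos i hi
    fin_cases i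
    · exact this.trans_le (le_max_left _ _)
    · exact this.trans_le (le_max_right _ _)
  simp only [key]
  exact ((continuous_normVal _ GF).tendsto x).div
    ((((continuous_normVal _ (F 0)).max (continuous_normVal _ (F 1))).pow n).tendsto x) hne

/-- The normalized value of the linear form vanishing at `q`. -/
def lval (q : Fin 2 → K) : BerkP1 K → ℝ := normVal 1 ⟨lform q, lform_isHomogeneous q⟩

theorem continuous_lval (q : Fin 2 → K) : Continuous (lval q) := continuous_normVal _ _

theorem lval_mk (q : Fin 2 → K) (x : PreBerk K) :
    lval q (Quotient.mk (PreBerk.setoid K) x) =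
      x.nrm (lform q) / max (x.nrm (X 0)) (x.nrm (X 1)) := by
  change _ / _ ^ 1 = _
  rw [pow_one]

theorem lval_ofP1 (q p : Fin 2 → K) (hp : p ≠ 0) :
    lval q (ofP1 (Projectivization.mk K p hp)) = ‖wedge q p‖ / ‖p‖ := by
  rw [ofP1_mk, lval_mk]
  change ‖eval p (lform q)‖ / max ‖eval p (X 0)‖ ‖eval p (X 1)‖ = _
  rw [eval_lform, eval_X, eval_X, norm_vec_eq]

theorem nrm_eq_prod (x : PreBerk K) (a : K) (S : Multiset (Fin 2 → K)) :
    x.nrm (C a * (S.map lform).prod) = ‖a‖ * (S.map fun q => x.nrm (lform q)).prod := by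
  rw [map_mul, x.map_C, map_multiset_prod, Multiset.map_map]
  rfl

theorem exists_normVal_eq_prod_lval [IsAlgClosed K] (n : ℕ)
    (G : homogeneousSubmodule (Fin 2) K n) :
    ∃ (a : K) (S : Multiset (Fin 2 → K)), ∀ x,
      normVal n G x = ‖a‖ * (S.map fun q => lval q x).prod := by
  obtain ⟨a, S, hS, -, hG⟩ := exists_eq_prod_lform ((mem_homogeneousSubmodule n _).mp G.2)
  refine ⟨a, S, fun x => ?_⟩
  induction x using Quotient.inductionOn with | h x => ?_
  change x.nrm (G : MvPolynomial (Fin 2) K) / _ ^ n = _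
  rw [hG, nrm_eq_prod]
  simp only [lval_mk]
  rw [Multiset.prod_map_div, Multiset.map_const', Multiset.prod_replicate, hS, mul_div_assoc]

theorem tendsto_nhds_iff_lval [IsAlgClosed K] {α : Type*} {l : Filter α} {g : α → BerkP1 K}
    {x : BerkP1 K} : Tendsto g l (𝓝 x) ↔ ∀ q, Tendsto (fun a => lval q (g a)) l (𝓝 (lval q x)) := by
  refine ⟨fun h q => ((continuous_lval q).tendsto x).comp h, fun h => ?_⟩
  refine tendsto_nhds_iff.2 fun n G => ?_
  obtain ⟨a, S, hS⟩ := exists_normVal_eq_prod_lval n G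
  simp only [hS]
  exact (tendsto_multiset_prod S fun q _ => h q).const_mul _

theorem eq_of_lval_eq [IsAlgClosed K] {x y : BerkP1 K} (h : ∀ q, lval q x = lval q y) : x = y := by
  refine eq_of_normVal_eq fun n G => ?_
  obtain ⟨a, S, hS⟩ := exists_normVal_eq_prod_lval n G
  simp only [hS, h]

theorem lval_eq_zero_iff [IsAlgClosed K] {p : Fin 2 → K} (hp : p ≠ 0) {x : BerkP1 K} :
    lval p x = 0 ↔ x = ofP1 (Projectivization.mk K p hp) := by
  constructor
  · intro h
    obtain ⟨i, hi⟩ : ∃ i, p i ≠ 0 := by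
      by_contra! h'; exact hp (funext h')
    refine eq_of_lval_eq fun q => ?_
    rw [lval_ofP1]
    induction x using Quotient.inductionOn with | h x => ?_
    have hx := x.max_nrm_pos
    rw [lval_mk, div_eq_zero_iff, or_iff_left hx.ne'] at h
    rw [lval_mk]
    have key : ∀ (q : Fin 2 → K) (i : Fin 2),
        ‖p i‖ * x.nrm (lform q) = ‖wedge q p‖ * x.nrm (X i) := by
      intro q i
      have e : C (p i) * lform q - C (wedge q p) * X i = C (q i) * lform p := by
        fin_cases i <;> simp [lform, wedge] <;> ring
      have h1 := abs_sub_map_le_sub x.nrm (C (p i) * lform q) (C (wedge q p) * X i)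
      rw [e, map_mul, map_mul, map_mul, x.map_C, x.map_C, h, mul_zero] at h1
      exact sub_eq_zero.1 (abs_eq_zero.1 (le_antisymm h1 (abs_nonneg _)))
    have hX : ∀ k l, ‖p k‖ * x.nrm (X l) = ‖p l‖ * x.nrm (X k) := by
      have e0 : x.nrm (lform ![1, 0]) = x.nrm (X 1) := by simp [lform]
      have e1 : x.nrm (lform ![0, 1]) = x.nrm (X 0) := by simp [lform, map_neg_eq_map]
      have w0 : ‖wedge ![1, 0] p‖ = ‖p 1‖ := by simp [wedge]
      have w1 : ‖wedge ![0, 1] p‖ = ‖p 0‖ := by simp [wedge]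
      intro k l
      fin_cases l
      · have := key ![0, 1] k
        rwa [e1, w1] at this
      · have := key ![1, 0] k
        rwa [e0, w0] at this
    have hmax : ‖p i‖ * max (x.nrm (X 0)) (x.nrm (X 1)) = ‖p‖ * x.nrm (X i) := by
      rw [mul_max_of_nonneg _ _ (norm_nonneg _), hX i 0, hX i 1, ← max_mul_of_nonneg _ _ (apply_nonneg _ _),
        norm_vec_eq]
    have hp0 := norm_pos_iff.2 hp
    have hi0 := norm_pos_iff.2 hi
    rw [div_eq_div_iff hx.ne' hp0.ne']
    refine mul_left_cancel₀ hi0.ne' ?_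
    linear_combination ‖p‖ * key q i - ‖wedge q p‖ * hmax
  · rintro rfl
    rw [lval_ofP1, wedge_self, norm_zero, zero_div]

theorem ofP1_injective [IsAlgClosed K] : Function.Injective (ofP1 (K := K)) := by
  intro z w h
  rw [← z.mk_rep, ← w.mk_rep] at h ⊢
  have h1 := (lval_eq_zero_iff w.rep_nonzero).2 h
  rw [lval_ofP1, div_eq_zero_iff, or_iff_left (norm_ne_zero_iff.2 z.rep_nonzero),
    norm_eq_zero] at h1
  rw [mk_eq_mk_iff_wedge, wedge_comm, h1, neg_zero]

theorem aeval_homLift_lform_ne_zero [IsAlgClosed K] {f : RatFunc K} (hf : 1 ≤ ratDegree f)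
    {q : Fin 2 → K} (hq : q ≠ 0) : aeval (homLift f) (lform q) ≠ 0 := by
  intro hG
  obtain ⟨k, hk⟩ : ∃ k, q k ≠ 0 := by
    by_contra! h'; exact hq (funext h')
  obtain ⟨p, hp, hp0⟩ := exists_eval_eq_zero hf (homLift_isHomogeneous f k)
  have hw : wedge q (liftVec f p) = 0 := by
    have := congrArg (eval p) hG
    simpa [lform, wedge, liftVec] using this
  refine liftVec_ne_zero f hp ?_
  have hk0 : liftVec f p k = 0 := hp0
  ext l
  simp only [wedge] at hw
  fin_cases k <;> fin_cases l <;> simp_all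

/-- The preimages of classical points are classical. -/
theorem mem_range_ofP1_of_map [IsAlgClosed K] {f : RatFunc K} (hf : 1 ≤ ratDegree f) {y : BerkP1 K}
    (h : map f y ∈ Set.range (ofP1 (K := K))) : y ∈ Set.range (ofP1 (K := K)) := by
  obtain ⟨z, hz⟩ := h
  rw [← z.mk_rep] at hz
  have h0 := (lval_eq_zero_iff z.rep_nonzero).2 hz.symm
  induction y using Quotient.inductionOn with | h y => ?_
  change lval _ (Quotient.mk _ (PreBerk.map f y)) = 0 at h0
  rw [lval_mk, div_eq_zero_iff, or_iff_left (PreBerk.max_nrm_pos _).ne'] at h0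
  change y.nrm (aeval (homLift f) (lform z.rep)) = 0 at h0
  have hG := aeval_homLift_lform_ne_zero hf z.rep_nonzero
  obtain ⟨a, S, -, hSne, hS⟩ := exists_eq_prod_lform
    ((lform_isHomogeneous z.rep).aeval _ (homLift_isHomogeneous f))
  rw [hS, nrm_eq_prod, mul_eq_zero, Multiset.prod_eq_zero_iff, Multiset.mem_map] at h0
  rcases h0 with h0 | ⟨q, hq, hq0⟩
  · rw [norm_eq_zero] at h0
    rw [h0, map_zero, zero_mul] at hS
    exact absurd hS hG
  · refine ⟨Projectivization.mk K q (hSne q hq), ((lval_eq_zero_iff (hSne q hq)).1 ?_).symm⟩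
    rw [lval_mk, hq0, zero_div]

end BerkP1

end Topology

section Chart

variable {K : Type*} [NontriviallyNormedField K]

/-- The classical point with coordinate `t` in the standard chart `i`, as a point of `𝖯¹`. -/
def chartPt (i : Fin 2) (t : K) : BerkP1 K :=
  BerkP1.ofP1 (Projectivization.mk K (chartVec i t) (chartVec_ne_zero i t))

theorem norm_chartVec (i : Fin 2) (t : K) : ‖chartVec i t‖ = max 1 ‖t‖ := by
  rw [norm_vec_eq]
  fin_cases i <;> simp [chartVec, max_comm]

theorem norm_wedge_chartVec (i : Fin 2) (s t : K) :
    ‖wedge (chartVec i s) (chartVec i t)‖ = ‖t - s‖ := by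
  fin_cases i <;> simp [chartVec, wedge, norm_sub_rev]

theorem continuous_chartPt [IsAlgClosed K] (i : Fin 2) : Continuous (chartPt (K := K) i) := by
  rw [continuous_iff_continuousAt]
  intro t
  refine BerkP1.tendsto_nhds_iff_lval.2 fun q => ?_
  simp only [chartPt, BerkP1.lval_ofP1, norm_chartVec]
  have h : Continuous fun t : K => ‖wedge q (chartVec i t)‖ := by
    fin_cases i <;> simp only [chartVec, wedge] <;> simp <;> fun_prop
  refine (h.tendsto t).div ((continuous_const.max continuous_norm).tendsto t) ?_
  exact (lt_of_lt_of_le one_pos (le_max_left _ _)).ne'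

open MvPolynomial in
/-- A bounded ultrafilter of classical points converges in `𝖯¹`. -/
theorem exists_tendsto_chartPt [IsAlgClosed K] (i : Fin 2) (U : Ultrafilter K) {B : ℝ}
    (hB : ∀ᶠ t in (U : Filter K), ‖t‖ ≤ B) : ∃ y, Tendsto (chartPt i) (U : Filter K) (𝓝 y) := by
  have hbdd : ∀ G : MvPolynomial (Fin 2) K, ∃ C : ℝ,
      ∀ᶠ t in (U : Filter K), ‖eval (chartVec i t) G‖ ≤ C := by
    intro G
    induction G using MvPolynomial.induction_on with
    | C a => exact ⟨‖a‖, by simp⟩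
    | add G H hG hH =>
      obtain ⟨C, hC⟩ := hG
      obtain ⟨D, hD⟩ := hH
      refine ⟨C + D, ?_⟩
      filter_upwards [hC, hD] with t h1 h2
      rw [map_add]
      exact (norm_add_le _ _).trans (add_le_add h1 h2)
    | mul_X G k hG =>
      obtain ⟨C, hC⟩ := hG
      refine ⟨C * max 1 B, ?_⟩
      filter_upwards [hC, hB] with t h1 h2
      rw [map_mul, eval_X, norm_mul]
      have h3 : ‖chartVec i t k‖ ≤ max 1 B :=
        (norm_le_pi_norm _ k).trans ((norm_chartVec i t).le.trans (max_le_max le_rfl h2))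
      exact mul_le_mul h1 h3 (norm_nonneg _) ((norm_nonneg _).trans h1)
  have hlim : ∀ G : MvPolynomial (Fin 2) K, ∃ l : ℝ,
      Tendsto (fun t => ‖eval (chartVec i t) G‖) U (𝓝 l) := by
    intro G
    obtain ⟨C, hC⟩ := hbdd G
    obtain ⟨l, -, hl⟩ := (isCompact_Icc (a := 0) (b := C)).ultrafilter_le_nhds
      (U.map fun t => ‖eval (chartVec i t) G‖) (by
        rw [le_principal_iff, Ultrafilter.coe_map, mem_map]
        filter_upwards [hC] with t ht
        exact ⟨norm_nonneg _, ht⟩)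
    exact ⟨l, hl⟩
  choose N hN using hlim
  let y : PreBerk K :=
    { nrm :=
        { toFun := N
          map_zero' := tendsto_nhds_unique (hN 0) (by simp)
          add_le' := fun G H => le_of_tendsto_of_tendsto' (hN _) ((hN G).add (hN H)) fun t => by
            rw [map_add]; exact norm_add_le _ _
          neg' := fun G => tendsto_nhds_unique (hN _) (by simpa using hN G)
          map_one' := tendsto_nhds_unique (hN 1) (by simp)
          map_mul' := fun G H => tendsto_nhds_unique (hN _) (by simpa using (hN G).mul (hN H)) }
      map_C := fun a => tendsto_nhds_unique (hN (C a)) (by simp)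
      ne_zero := ⟨i, by
        have : N (X i) = 1 := tendsto_nhds_unique (hN (X i)) (by simp [chartVec])
        change N (X i) ≠ 0
        rw [this]; exact one_ne_zero⟩ }
  refine ⟨Quotient.mk _ y, BerkP1.tendsto_nhds_iff_lval.2 fun q => ?_⟩
  rw [BerkP1.lval_mk]
  have h := (hN (lform q)).div ((hN (X 0)).max (hN (X 1))) (PreBerk.max_nrm_pos y).ne'
  refine h.congr fun t => ?_
  rw [chartPt, BerkP1.lval_ofP1, norm_vec_eq, Pi.div_apply, eval_lform, eval_X, eval_X]

theorem iterate_map_chartPt (f : RatFunc K) (n : ℕ) (i : Fin 2) (t : K) :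
    (BerkP1.map f)^[n] (chartPt i t) = BerkP1.ofP1 (Projectivization.mk K
      ((liftVec f)^[n] (chartVec i t)) (iterate_liftVec_ne_zero f (chartVec_ne_zero i t) n)) := by
  rw [chartPt, iterate_map_ofP1, iterate_ratMap_mk]

/-- If `f^n` of a closed set containing a classical disc omits `b`, then `f^n` of the disc stays
away from a neighbourhood of `b`. -/
theorem exists_nhds_forall_notMem [IsAlgClosed K] (f : RatFunc K) (n : ℕ) {A : Set (BerkP1 K)}
    (hA : IsClosed A) {i : Fin 2} {t₀ : K} {ρ : ℝ} (hρ : ∀ t, ‖t‖ < ρ → chartPt i (t + t₀) ∈ A)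
    {b : BerkP1 K} (hb : b ∉ (BerkP1.map f)^[n] '' A) :
    ∃ W ∈ 𝓝 b, ∀ t, ‖t‖ < ρ → (BerkP1.map f)^[n] (chartPt i (t + t₀)) ∉ W := by
  by_contra! hW
  set g : K → BerkP1 K := fun t => (BerkP1.map f)^[n] (chartPt i t) with hg
  set D : Set K := {t | ‖t - t₀‖ < ρ} with hD
  have hne : (comap g (𝓝 b) ⊓ 𝓟 D).NeBot := by
    refine (((𝓝 b).basis_sets.comap g).inf_principal D).neBot_iff.2 fun {W} hWb => ?_
    obtain ⟨t, ht, htW⟩ := hW W hWb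
    exact ⟨t + t₀, htW, by simpa [hD] using ht⟩
  obtain ⟨U, hU⟩ := Ultrafilter.exists_le (comap g (𝓝 b) ⊓ 𝓟 D)
  have hUD : ∀ᶠ t in (U : Filter K), t ∈ D := le_principal_iff.1 (hU.trans inf_le_right)
  have hUb : Tendsto g U (𝓝 b) := tendsto_iff_comap.2 (hU.trans inf_le_left)
  obtain ⟨y, hy⟩ := exists_tendsto_chartPt i U (B := ρ + ‖t₀‖) (by
    filter_upwards [hUD] with t ht
    have h1 := norm_add_le (t - t₀) t₀
    rw [sub_add_cancel] at h1
    have h2 : ‖t - t₀‖ < ρ := ht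
    linarith)
  have hyA : y ∈ A := hA.mem_of_tendsto hy (by
    filter_upwards [hUD] with t ht
    have := hρ (t - t₀) ht
    rwa [sub_add_cancel] at this)
  refine hb ⟨y, hyA, ?_⟩
  exact tendsto_nhds_unique
    ((((BerkP1.continuous_map f).iterate n).tendsto y).comp hy) hUb

end Chart

section Density

variable {K : Type*} [NontriviallyNormedField K]

theorem exists_norm_mem_Ioo [IsAlgClosed K] {a b : ℝ} (ha : 0 ≤ a) (hab : a < b) :
    ∃ y : K, a < ‖y‖ ∧ ‖y‖ < b := by
  obtain ⟨z, hz⟩ := NormedField.exists_one_lt_norm K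
  obtain ⟨w, hw0, hwb⟩ := NormedField.exists_norm_lt K (ha.trans_lt hab)
  rcases lt_or_ge a ‖w‖ with haw | haw
  · exact ⟨w, haw, hwb⟩
  have ha0 : 0 < a := hw0.trans_le haw
  have hlim : Tendsto (fun n : ℕ => ‖z‖ ^ ((1 : ℝ) / (n + 1))) atTop (𝓝 1) := by
    have h1 : Tendsto (fun n : ℕ => (1 : ℝ) / (n + 1)) atTop (𝓝 0) :=
      tendsto_one_div_add_atTop_nhds_zero_nat
    have h2 := (Real.continuous_const_rpow (a := ‖z‖) (by linarith)).tendsto 0 |>.comp h1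
    rwa [Real.rpow_zero] at h2
  obtain ⟨n, hn⟩ := (hlim.eventually (gt_mem_nhds ((one_lt_div ha0).2 hab))).exists
  obtain ⟨u, hu⟩ := IsAlgClosed.exists_pow_nat_eq z (n := n + 1) (Nat.succ_pos n)
  have hun : ‖u‖ ^ (n + 1) = ‖z‖ := by rw [← norm_pow, hu]
  have hu1 : 1 < ‖u‖ := by
    by_contra! h
    have := pow_le_one₀ (n := n + 1) (norm_nonneg u) h
    linarith
  have hub : ‖u‖ < b / a := by
    have : ‖z‖ ^ ((1 : ℝ) / (n + 1)) = ‖u‖ := by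
      rw [← hun, ← Real.rpow_natCast, ← Real.rpow_mul (norm_nonneg u)]
      push_cast
      rw [mul_one_div_cancel (by positivity), Real.rpow_one]
    rwa [this] at hn
  have hex : ∃ k : ℕ, a < ‖w * u ^ k‖ := by
    obtain ⟨k, hk⟩ := pow_unbounded_of_one_lt (a / ‖w‖) hu1
    refine ⟨k, ?_⟩
    rw [norm_mul, norm_pow]
    rwa [div_lt_iff₀' hw0] at hk
  classical
  have hk := Nat.find_spec hex
  have hk0 : Nat.find hex ≠ 0 := by
    intro h
    rw [h] at hk
    simp at hk
    linarith
  obtain ⟨k, hkk⟩ := Nat.exists_eq_succ_of_ne_zero hk0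
  have hmin := Nat.find_min hex (m := k) (by omega)
  refine ⟨_, hk, ?_⟩
  rw [hkk, pow_succ, ← mul_assoc, norm_mul]
  push Not at hmin
  calc ‖w * u ^ k‖ * ‖u‖ ≤ a * ‖u‖ := by gcongr
    _ < a * (b / a) := by gcongr
    _ = b := by field_simp

theorem exists_norm_mem_Ioo_notMem [IsAlgClosed K] {a b : ℝ} (ha : 0 ≤ a) (hab : a < b)
    (F : Finset ℝ) : ∃ y : K, a < ‖y‖ ∧ ‖y‖ < b ∧ ‖y‖ ∉ F := by
  induction F using Finset.induction_on generalizing a b with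
  | empty =>
    obtain ⟨y, h1, h2⟩ := exists_norm_mem_Ioo (K := K) ha hab
    exact ⟨y, h1, h2, by simp⟩
  | insert c F _ ih =>
    rcases le_or_gt c ((a + b) / 2) with hc | hc
    · obtain ⟨y, h1, h2, h3⟩ := ih (a := (a + b) / 2) (b := b) (by linarith) (by linarith)
      refine ⟨y, by linarith, h2, ?_⟩
      rw [Finset.mem_insert, not_or]
      exact ⟨(hc.trans_lt h1).ne', h3⟩
    · obtain ⟨y, h1, h2, h3⟩ := ih (a := a) (b := (a + b) / 2) ha (by linarith)
      refine ⟨y, h1, by linarith, ?_⟩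
      rw [Finset.mem_insert, not_or]
      exact ⟨(h2.trans hc).ne, h3⟩

/-- Approximation of an ultrametric distance profile `r` by two points that are far apart. -/
theorem exists_pair_norm_sub_near [IsAlgClosed K] [IsUltrametricDist K] {r : K → ℝ} {δ : ℝ}
    (hδ : 0 < δ) (hr : ∀ a, δ ≤ r a) (h1 : ∀ a b, r a ≤ max (r b) ‖a - b‖)
    (h2 : ∀ a b, ‖a - b‖ ≤ max (r a) (r b)) (S : Finset K) (hS : S.Nonempty) {ε : ℝ} (hε : 0 < ε) :
    ∃ t t' : K, (∀ α ∈ S, ‖t - α‖ ≤ r α ∧ r α - ε ≤ ‖t - α‖) ∧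
      (∀ α ∈ S, ‖t' - α‖ ≤ r α ∧ r α - ε ≤ ‖t' - α‖) ∧ δ / 2 ≤ ‖t - t'‖ := by
  classical
  obtain ⟨a, haS, hmin⟩ := S.exists_min_image r hS
  have hra : ∀ α ∈ S, r α = max (r a) ‖a - α‖ := by
    intro α hα
    refine le_antisymm ?_ (max_le (hmin α hα) ((h2 a α).trans (max_le (hmin α hα) le_rfl)))
    rw [norm_sub_rev]
    exact h1 α a
  set F : Finset ℝ := S.image fun α => ‖a - α‖ with hF
  have hgood : ∀ y : K, r a - ε < ‖y‖ → ‖y‖ < r a → ‖y‖ ∉ F →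
      ∀ α ∈ S, ‖a + y - α‖ ≤ r α ∧ r α - ε ≤ ‖a + y - α‖ := by
    intro y hy1 hy2 hyF α hα
    have hne : ‖y‖ ≠ ‖a - α‖ := fun h => hyF (h ▸ Finset.mem_image_of_mem _ hα)
    have e : ‖a + y - α‖ = max ‖y‖ ‖a - α‖ := by
      rw [show a + y - α = y + (a - α) by ring]
      exact IsUltrametricDist.norm_add_eq_max_of_norm_ne_norm hne
    rw [e, hra α hα]
    refine ⟨max_le_max hy2.le le_rfl, ?_⟩
    rcases le_total (r a) ‖a - α‖ with h | h
    · rw [max_eq_right h]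
      exact (by linarith : ‖a - α‖ - ε ≤ ‖a - α‖).trans (le_max_right _ _)
    · rw [max_eq_left h]
      exact hy1.le.trans (le_max_left _ _)
  have hlo : max (r a - ε) (r a / 2) < r a := max_lt (by linarith) (by linarith [hr a])
  have hlo0 : 0 ≤ max (r a - ε) (r a / 2) := le_max_of_le_right (by linarith [hr a])
  obtain ⟨y, hy1, hy2, hy3⟩ := exists_norm_mem_Ioo_notMem (K := K) hlo0 hlo F
  obtain ⟨y', hy1', hy2', hy3'⟩ := exists_norm_mem_Ioo_notMem (K := K) (norm_nonneg y) hy2 F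
  refine ⟨a + y, a + y', hgood y ((le_max_left _ _).trans_lt hy1) hy2 hy3,
    hgood y' (((le_max_left _ _).trans_lt hy1).trans hy1') hy2' hy3', ?_⟩
  have e : ‖a + y - (a + y')‖ = ‖y'‖ := by
    rw [show a + y - (a + y') = y + -y' by ring,
      IsUltrametricDist.norm_add_eq_max_of_norm_ne_norm (by rw [norm_neg]; exact hy1'.ne),
      norm_neg, max_eq_right hy1'.le]
  rw [e]
  have := (le_max_right (r a - ε) (r a / 2)).trans_lt hy1
  linarith [hr a]

theorem exists_pos_le_of_complete [CompleteSpace K] {r : K → ℝ} (h0 : ∀ a, 0 < r a)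
    (h1 : ∀ a b, r a ≤ max (r b) ‖a - b‖) (h2 : ∀ a b, ‖a - b‖ ≤ max (r a) (r b)) :
    ∃ δ : ℝ, 0 < δ ∧ ∀ a, δ ≤ r a := by
  by_contra! h
  choose a ha using fun n : ℕ => h ((1 : ℝ) / (n + 1)) (by positivity)
  have hlim : Tendsto (fun n : ℕ => (1 : ℝ) / (n + 1)) atTop (𝓝 0) :=
    tendsto_one_div_add_atTop_nhds_zero_nat
  have hra : Tendsto (fun n => r (a n)) atTop (𝓝 0) :=
    squeeze_zero (fun n => (h0 _).le) (fun n => (ha n).le) hlim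
  have hcau : CauchySeq a := by
    refine cauchySeq_of_le_tendsto_0 (fun n : ℕ => (1 : ℝ) / (n + 1)) (fun n m N hn hm => ?_) hlim
    rw [dist_eq_norm]
    refine (h2 _ _).trans (max_le ((ha n).le.trans ?_) ((ha m).le.trans ?_)) <;>
      gcongr
  obtain ⟨l, hl⟩ := cauchySeq_tendsto_of_complete hcau
  have h3 : Tendsto (fun n => max (r (a n)) ‖l - a n‖) atTop (𝓝 (max 0 0)) := by
    refine hra.max ?_
    have := (tendsto_const_nhds (x := l)).sub hl |>.norm
    simpa using this
  have := ge_of_tendsto' h3 fun n => h1 l (a n)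
  rw [max_self] at this
  exact absurd (h0 l) (not_lt.2 this)

theorem map_add_le_max_of_natCast_le_one {A : Type*} [CommRing A] (N : MulRingSeminorm A)
    (h : ∀ n : ℕ, N n ≤ 1) (a b : A) : N (a + b) ≤ max (N a) (N b) := by
  set M := max (N a) (N b) with hM
  have hM0 : 0 ≤ M := (apply_nonneg N a).trans (le_max_left _ _)
  have hpow : ∀ n : ℕ, N (a + b) ^ n ≤ (n + 1) * M ^ n := by
    intro n
    rw [← map_pow, add_pow]
    have hsum : ∀ s : Finset ℕ, ∀ g : ℕ → A, N (∑ m ∈ s, g m) ≤ ∑ m ∈ s, N (g m) := fun s g =>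
      Finset.le_sum_of_subadditive N (map_zero N).le (fun x y => map_add_le_add N x y) s g
    refine (hsum _ _).trans ?_
    have hterm : ∀ m ∈ Finset.range (n + 1), N (a ^ m * b ^ (n - m) * (n.choose m : A)) ≤ M ^ n := by
      intro m hm
      have hmn : m + (n - m) = n := Nat.add_sub_cancel' (Nat.lt_succ_iff.1 (Finset.mem_range.1 hm))
      rw [map_mul, map_mul, map_pow, map_pow]
      calc N a ^ m * N b ^ (n - m) * N (n.choose m : A)
          ≤ M ^ m * M ^ (n - m) * 1 := by
            gcongr
            · exact le_max_left _ _
            · exact le_max_right _ _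
            · exact h _
        _ = M ^ n := by rw [mul_one, ← pow_add, hmn]
    refine (Finset.sum_le_card_nsmul _ _ _ hterm).trans (le_of_eq ?_)
    simp
  by_contra! hlt
  rcases hM0.eq_or_lt with h0 | h0
  · have := hpow 1
    rw [← h0] at this hlt
    simp at this
    linarith
  have hq : 1 < N (a + b) / M := (one_lt_div h0).2 hlt
  have hlim := tendsto_pow_const_div_const_pow_of_one_lt 1 hq
  have hlim2 := tendsto_pow_const_div_const_pow_of_one_lt 0 hq
  have hlim3 := hlim.add hlim2
  rw [add_zero] at hlim3
  obtain ⟨n, hn⟩ := (hlim3.eventually (gt_mem_nhds one_pos)).exists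
  rw [pow_one, pow_zero, ← add_div, div_lt_one (by positivity), div_pow,
    lt_div_iff₀ (by positivity)] at hn
  exact absurd (hpow n) (not_le.2 hn)

open MvPolynomial in
/-- In the ultrametric case, every neighbourhood of a non-classical point contains two classical
points whose distance is bounded below. -/
theorem exists_far_pair_of_mem_nhds [CompleteSpace K] [IsAlgClosed K] [IsUltrametricDist K]
    {x : BerkP1 K} (hx : x ∉ Set.range (BerkP1.ofP1 (K := K))) :
    ∃ δ : ℝ, 0 < δ ∧ ∀ W ∈ 𝓝 x, ∃ (p q : Fin 2 → K) (hp : p ≠ 0) (hq : q ≠ 0),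
      BerkP1.ofP1 (Projectivization.mk K p hp) ∈ W ∧
      BerkP1.ofP1 (Projectivization.mk K q hq) ∈ W ∧ δ ≤ vdist p q := by
  induction x using Quotient.inductionOn with | h x => ?_
  have hM := x.max_nrm_pos
  set M := max (x.nrm (X 0)) (x.nrm (X 1)) with hMdef
  obtain ⟨i, hi⟩ : ∃ i : Fin 2, x.nrm (X i) = M := by
    rcases max_choice (x.nrm (X 0)) (x.nrm (X 1)) with h | h
    · exact ⟨0, h.symm⟩
    · exact ⟨1, h.symm⟩
  have hle : ∀ k, x.nrm (X k) ≤ M := by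
    intro k; fin_cases k
    · exact le_max_left _ _
    · exact le_max_right _ _
  have hna := map_add_le_max_of_natCast_le_one x.nrm (fun n => by
    have := x.map_C (n : K)
    rw [map_natCast] at this
    rw [this]
    exact IsUltrametricDist.norm_natCast_le_one K n)
  set r : K → ℝ := fun a => x.nrm (lform (chartVec i a)) / M with hr
  have hr_eq : ∀ a, r a = BerkP1.lval (chartVec i a) (Quotient.mk _ x) := fun a =>
    (BerkP1.lval_mk _ _).symm
  have hform : ∀ a b : K, ∃ e : K, ‖e‖ = ‖a - b‖ ∧
      lform (chartVec i a) = lform (chartVec i b) + C e * X i := by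
    intro a b
    fin_cases i
    · exact ⟨b - a, norm_sub_rev _ _, by simp [lform, chartVec]; ring⟩
    · exact ⟨a - b, rfl, by simp [lform, chartVec]; ring⟩
  have h0 : ∀ a, 0 < r a := by
    intro a
    refine lt_of_le_of_ne (div_nonneg (apply_nonneg _ _) hM.le) fun h => hx ?_
    rw [hr_eq] at h
    exact ⟨_, ((BerkP1.lval_eq_zero_iff (chartVec_ne_zero i a)).1 h.symm).symm⟩
  have h1 : ∀ a b, r a ≤ max (r b) ‖a - b‖ := by
    intro a b
    obtain ⟨e, he, hab⟩ := hform a b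
    have := hna (lform (chartVec i b)) (C e * X i)
    rw [← hab, map_mul, x.map_C, he, hi] at this
    simp only [hr]
    rw [div_le_iff₀ hM, max_mul_of_nonneg _ _ hM.le, div_mul_cancel₀ _ hM.ne']
    exact this
  have h2 : ∀ a b, ‖a - b‖ ≤ max (r a) (r b) := by
    intro a b
    obtain ⟨e, he, hab⟩ := hform a b
    have := hna (lform (chartVec i a)) (-lform (chartVec i b))
    rw [hab, map_neg_eq_map, show lform (chartVec i b) + C e * X i + -lform (chartVec i b) =
      C e * X i by ring, map_mul, x.map_C, he, hi, ← hab] at this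
    simp only [hr]
    rw [max_div_div_right hM.le, le_div_iff₀ hM]
    exact this
  have hr0 : r 0 ≤ 1 := by
    rw [hr]
    refine (div_le_one hM).2 ?_
    fin_cases i
    · simpa [lform, chartVec] using hle 1
    · simpa [lform, chartVec, map_neg_eq_map] using hle 0
  obtain ⟨δ, hδ, hδr⟩ := exists_pos_le_of_complete h0 h1 h2
  refine ⟨δ / 2, half_pos hδ, fun W hW => ?_⟩
  classical
  choose t t' ht ht' htt' using fun s : Finset K × ℕ =>
    exists_pair_norm_sub_near hδ hδr h1 h2 (insert 0 s.1) (Finset.insert_nonempty _ _)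
      (ε := 1 / ((s.2 : ℝ) + 1)) (by positivity)
  have hnorm : ∀ u : Finset K × ℕ → K, (∀ s, ∀ α ∈ insert 0 s.1, ‖u s - α‖ ≤ r α ∧
      r α - 1 / ((s.2 : ℝ) + 1) ≤ ‖u s - α‖) → ∀ s, ‖chartVec i (u s)‖ = 1 := by
    intro u hu s
    rw [norm_chartVec]
    refine max_eq_left ?_
    have := (hu s 0 (Finset.mem_insert_self _ _)).1
    rw [sub_zero] at this
    exact this.trans hr0
  have hconv : ∀ u : Finset K × ℕ → K, (∀ s, ∀ α ∈ insert 0 s.1, ‖u s - α‖ ≤ r α ∧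
      r α - 1 / ((s.2 : ℝ) + 1) ≤ ‖u s - α‖) →
      Tendsto (fun s => chartPt i (u s)) atTop (𝓝 (Quotient.mk _ x)) := by
    intro u hu
    have hα : ∀ α, Tendsto (fun s => ‖u s - α‖) atTop (𝓝 (r α)) := by
      intro α
      have hmem : ∀ᶠ s : Finset K × ℕ in atTop, α ∈ insert 0 s.1 := by
        filter_upwards [eventually_ge_atTop (({α} : Finset K), 0)] with s hs
        exact Finset.mem_insert_of_mem (hs.1 (Finset.mem_singleton_self α))
      have hlim : Tendsto (fun s : Finset K × ℕ => r α - 1 / ((s.2 : ℝ) + 1)) atTop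
          (𝓝 (r α - 0)) := by
        refine tendsto_const_nhds.sub (tendsto_one_div_add_atTop_nhds_zero_nat.comp ?_)
        rw [← prod_atTop_atTop_eq]
        exact tendsto_snd
      rw [sub_zero] at hlim
      refine tendsto_of_tendsto_of_tendsto_of_le_of_le' hlim tendsto_const_nhds ?_ ?_
      · filter_upwards [hmem] with s hs using (hu s α hs).2
      · filter_upwards [hmem] with s hs using (hu s α hs).1
    refine BerkP1.tendsto_nhds_iff_lval.2 fun q => ?_
    simp only [chartPt, BerkP1.lval_ofP1, hnorm u hu, div_one]
    rw [BerkP1.lval_mk]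
    change Tendsto _ _ (𝓝 (x.nrm (lform q) / M))
    by_cases hqi : q i = 0
    · have e1 : x.nrm (lform q) / M = ‖q (i + 1)‖ := by
        have : x.nrm (lform q) = ‖q (i + 1)‖ * x.nrm (X i) := by
          rw [← x.map_C, ← map_mul]
          fin_cases i
          · simp at hqi; simp [lform, hqi, map_neg_eq_map]
          · simp at hqi; simp [lform, hqi]
        rw [this, hi, mul_div_cancel_right₀ _ hM.ne']
      have e2 : ∀ s, ‖wedge q (chartVec i (u s))‖ = ‖q (i + 1)‖ := by
        intro s
        fin_cases i
        · simp at hqi; simp [wedge, chartVec, hqi]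
        · simp at hqi; simp [wedge, chartVec, hqi]
      simp only [e1, e2]
      exact tendsto_const_nhds
    · have hq : q = q i • chartVec i (q (i + 1) / q i) := by
        ext k
        fin_cases i <;> fin_cases k <;> simp [chartVec] at hqi ⊢ <;> field_simp
      have hl : lform q = C (q i) * lform (chartVec i (q (i + 1) / q i)) := by
        conv_lhs => rw [hq]
        simp [lform]; ring
      rw [hl, map_mul, x.map_C, mul_div_assoc]
      have e2 : ∀ s, ‖wedge q (chartVec i (u s))‖ = ‖q i‖ * ‖u s - q (i + 1) / q i‖ := by
        intro s
        conv_lhs => rw [hq]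
        rw [wedge_smul_left, norm_mul, norm_wedge_chartVec]
      simp only [e2]
      exact (hα _).const_mul _
  obtain ⟨s, hs1, hs2⟩ := (((hconv t ht).eventually hW).and ((hconv t' ht').eventually hW)).exists
  refine ⟨_, _, chartVec_ne_zero i (t s), chartVec_ne_zero i (t' s), hs1, hs2, ?_⟩
  rw [vdist, hnorm t ht, hnorm t' ht', norm_wedge_chartVec, mul_one, div_one, norm_sub_rev]
  exact htt' s

end Density

section Omitted

variable {K : Type*} [NontriviallyNormedField K] [IsAlgClosed K]

theorem mem_range_ofP1_of_iterate_map {f : RatFunc K} (hf : 1 ≤ ratDegree f) (n : ℕ)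
    {y : BerkP1 K} (h : (BerkP1.map f)^[n] y ∈ Set.range (BerkP1.ofP1 (K := K))) :
    y ∈ Set.range (BerkP1.ofP1 (K := K)) := by
  induction n with
  | zero => exact h
  | succ n ih =>
    rw [Function.iterate_succ_apply'] at h
    exact ih (BerkP1.mem_range_ofP1_of_map hf h)

/-- A point of the finite backward orbit of an exceptional point is periodic. -/
theorem exists_periodic_of_mem_exceptional {f : RatFunc K} (hf : 1 ≤ ratDegree f) {c : P1 K}
    {n : ℕ} (h : (BerkP1.map f)^[n] (BerkP1.ofP1 c) ∈ exceptional f) :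
    ∃ m, 1 ≤ m ∧ (ratMap f)^[m] c = c := by
  set b := (BerkP1.map f)^[n] (BerkP1.ofP1 c) with hb
  obtain ⟨g, hg⟩ := (ratMap_surjective hf).hasRightInverse
  have hgk : ∀ k z, (ratMap f)^[k] (g^[k] z) = z := fun k z => hg.iterate k z
  have hmem : ∀ k, 1 ≤ k → BerkP1.ofP1 (g^[k] c) ∈
      ⋃ n ∈ {n : ℕ | 1 ≤ n}, (BerkP1.map f)^[n] ⁻¹' {b} := by
    intro k hk
    simp only [Set.mem_iUnion]
    refine ⟨n + k, (by omega : 1 ≤ n + k), ?_⟩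
    rw [Set.mem_preimage, Function.iterate_add_apply, iterate_map_ofP1, hgk]
    rfl
  obtain ⟨k, hk, l, -, hkl, heq⟩ := (Set.Ici_infinite 1).exists_lt_map_eq_of_mapsTo
    (f := fun k => BerkP1.ofP1 (g^[k] c)) hmem h.2
  have heq' : g^[k] c = g^[l] c := BerkP1.ofP1_injective heq
  obtain ⟨m, rfl⟩ := Nat.exists_eq_add_of_le hkl.le
  have h2 : c = g^[m] c := by
    have := congrArg (ratMap f)^[k] heq'
    rwa [hgk, Function.iterate_add_apply, hgk] at this
  refine ⟨m, by omega, ?_⟩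
  conv_lhs => rw [h2]
  exact hgk m c

/-- A non-periodic classical point of the Fatou set has a neighbourhood whose forward orbit omits a
non-exceptional point. -/
theorem exists_omitted_of_mem_fatou {f : RatFunc K} (hf : 1 ≤ ratDegree f) {c : P1 K}
    (hc : BerkP1.ofP1 c ∈ fatou f) (hper : ∀ n, 1 ≤ n → (ratMap f)^[n] c ≠ c) :
    ∃ b ∉ exceptional f, ∃ V, IsOpen V ∧ BerkP1.ofP1 c ∈ V ∧
      ∀ n, 1 ≤ n → b ∉ (BerkP1.map f)^[n] '' V := by
  by_contra! h
  refine hc (Set.Subset.antisymm (fun b hb hbE => ?_) fun b hb => ?_)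
  · simp only [Set.mem_iInter, Set.mem_iUnion] at hb
    by_cases hcB : BerkP1.ofP1 c ∈ ⋃ n ∈ {n : ℕ | 1 ≤ n}, (BerkP1.map f)^[n] ⁻¹' {b}
    · simp only [Set.mem_iUnion] at hcB
      obtain ⟨n, -, hn⟩ := hcB
      have hn' : (BerkP1.map f)^[n] (BerkP1.ofP1 c) = b := hn
      obtain ⟨m, hm, hmc⟩ := exists_periodic_of_mem_exceptional hf (hn'.symm ▸ hbE)
      exact hper m hm hmc
    · obtain ⟨n, hn, y, hy, hyb⟩ := hb _ ⟨hbE.2.isClosed.isOpen_compl, hcB⟩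
      refine hy ?_
      simp only [Set.mem_iUnion]
      exact ⟨n, hn, hyb⟩
  · simp only [Set.mem_iInter, Set.mem_iUnion]
    rintro V ⟨hV, hcV⟩
    obtain ⟨n, hn, hbn⟩ := h b hb V hV hcV
    exact ⟨n, hn, hbn⟩

theorem infinite_omitted {f : RatFunc K} (hf : 1 ≤ ratDegree f) {b : BerkP1 K}
    (hb : b ∈ Set.range (BerkP1.ofP1 (K := K))) (hbE : b ∉ exceptional f) {V : Set (BerkP1 K)}
    (hV : ∀ n, 1 ≤ n → b ∉ (BerkP1.map f)^[n] '' V) :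
    {z : P1 K | ∀ n, 1 ≤ n → BerkP1.ofP1 z ∉ (BerkP1.map f)^[n] '' V}.Infinite := by
  intro hfin
  refine hbE ⟨hb, (hfin.image BerkP1.ofP1).subset fun y hy => ?_⟩
  simp only [Set.mem_iUnion] at hy
  obtain ⟨m, -, hm⟩ := hy
  have hm' : (BerkP1.map f)^[m] y = b := hm
  obtain ⟨z, rfl⟩ := mem_range_ofP1_of_iterate_map hf m (hm'.symm ▸ hb)
  refine ⟨z, fun n hn => ?_, rfl⟩
  rintro ⟨w, hw, hwz⟩
  refine hV (m + n) (by omega) ⟨w, hw, ?_⟩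
  rw [Function.iterate_add_apply, hwz, hm']

end Omitted

section Quadratic

variable {K : Type*} [NontriviallyNormedField K]

theorem norm_sub_le_max_norm [IsUltrametricDist K] (x y : K) : ‖x - y‖ ≤ max ‖x‖ ‖y‖ := by
  rw [sub_eq_add_neg, ← norm_neg y]
  exact IsUltrametricDist.norm_add_le_max x (-y)

theorem wedge_mul_wedge_sub {R : Type*} [CommRing R] (p q u v : Fin 2 → R) :
    wedge p u * wedge q v - wedge p v * wedge q u = wedge p q * wedge u v := by
  simp only [wedge]; ring

/-- The linear form vanishing at `p`, along a polynomial curve. -/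
def lpoly (p : Fin 2 → K) (N : Fin 2 → Polynomial K) : Polynomial K :=
  Polynomial.C (p 0) * N 1 - Polynomial.C (p 1) * N 0

theorem eval_lpoly (p : Fin 2 → K) (N : Fin 2 → Polynomial K) (t : K) :
    (lpoly p N).eval t = wedge p (fun i => (N i).eval t) := by
  simp [lpoly, wedge]

theorem eval_derivative_lpoly (p : Fin 2 → K) (N : Fin 2 → Polynomial K) (t : K) :
    (lpoly p N).derivative.eval t = wedge p (fun i => (N i).derivative.eval t) := by
  simp [lpoly, wedge]

theorem lpoly_wronskian {p q : Fin 2 → K} {N : Fin 2 → Polynomial K} {t : K}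
    (h : wronAt N t = 0) : (lpoly p N).derivative.eval t * (lpoly q N).eval t -
      (lpoly p N).eval t * (lpoly q N).derivative.eval t = 0 := by
  simp only [eval_lpoly, eval_derivative_lpoly]
  rw [wedge_mul_wedge_sub]
  change _ * wronAt N t = 0
  rw [h, mul_zero]

theorem coeff_and_eval_bound_of_roots [IsUltrametricDist K] {ρ : ℝ} (hρ : 0 < ρ) (S : Multiset K)
    (hS : ∀ α ∈ S, ρ ≤ ‖α‖) :
    let A := (S.map fun α => Polynomial.X - Polynomial.C α).prod
    (∀ k, ‖A.coeff k‖ * ρ ^ k ≤ ‖A.coeff 0‖) ∧ ∀ t, ‖t‖ < ρ → ‖A.eval t‖ = ‖A.coeff 0‖ := by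
  induction S using Multiset.induction_on with
  | empty =>
    refine ⟨fun k => ?_, fun t _ => by simp⟩
    rcases k with _ | k
    · simp
    · simp [Polynomial.coeff_one]
  | cons α S ih =>
    obtain ⟨h1, h2⟩ := ih fun β hβ => hS β (Multiset.mem_cons_of_mem hβ)
    have hα := hS α (Multiset.mem_cons_self α S)
    set A := (S.map fun α => Polynomial.X - Polynomial.C α).prod with hA
    have e0 : ((Polynomial.X - Polynomial.C α) * A).coeff 0 = -(α * A.coeff 0) := by
      simp [sub_mul]
    simp only [Multiset.map_cons, Multiset.prod_cons, ← hA]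
    refine ⟨fun k => ?_, fun t ht => ?_⟩
    · rw [e0, norm_neg, norm_mul]
      rcases k with _ | k
      · rw [e0, norm_neg, norm_mul, pow_zero, mul_one]
      · rw [sub_mul, Polynomial.coeff_sub, Polynomial.coeff_X_mul, Polynomial.coeff_C_mul]
        have hb1 : ‖A.coeff k‖ * ρ ^ (k + 1) ≤ ‖α‖ * ‖A.coeff 0‖ := by
          rw [pow_succ, ← mul_assoc, mul_comm ‖α‖]
          exact mul_le_mul (h1 k) hα hρ.le (norm_nonneg _)
        have hb2 : ‖α * A.coeff (k + 1)‖ * ρ ^ (k + 1) ≤ ‖α‖ * ‖A.coeff 0‖ := by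
          rw [norm_mul, mul_assoc]
          exact mul_le_mul_of_nonneg_left (h1 (k + 1)) (norm_nonneg _)
        have hmax : ‖A.coeff k - α * A.coeff (k + 1)‖ ≤ max ‖A.coeff k‖ ‖α * A.coeff (k + 1)‖ :=
          norm_sub_le_max_norm _ _
        calc ‖A.coeff k - α * A.coeff (k + 1)‖ * ρ ^ (k + 1)
            ≤ max ‖A.coeff k‖ ‖α * A.coeff (k + 1)‖ * ρ ^ (k + 1) := by gcongr
          _ ≤ ‖α‖ * ‖A.coeff 0‖ := by
            rw [max_mul_of_nonneg _ _ (by positivity)]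
            exact max_le hb1 hb2
    · rw [e0, norm_neg, norm_mul, Polynomial.eval_mul, norm_mul, h2 t ht]
      congr 1
      have : ‖t + -α‖ = max ‖t‖ ‖-α‖ :=
        IsUltrametricDist.norm_add_eq_max_of_norm_ne_norm 
          (by rw [norm_neg]; exact (ht.trans_le hα).ne)
      rw [Polynomial.eval_sub, Polynomial.eval_X, Polynomial.eval_C, sub_eq_add_neg, this, norm_neg,
        max_eq_right (ht.trans_le hα).le]

/-- A polynomial without zeros in an ultrametric disc is dominated by its constant term. -/
theorem coeff_and_eval_bound [IsUltrametricDist K] [IsAlgClosed K] {ρ : ℝ} (hρ : 0 < ρ)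
    {A : Polynomial K} (hA : ∀ t, ‖t‖ < ρ → A.eval t ≠ 0) :
    (∀ k, ‖A.coeff k‖ * ρ ^ k ≤ ‖A.coeff 0‖) ∧ ∀ t, ‖t‖ < ρ → ‖A.eval t‖ = ‖A.coeff 0‖ := by
  have hs := (IsAlgClosed.splits A).eq_prod_roots
  obtain ⟨h1, h2⟩ := coeff_and_eval_bound_of_roots hρ A.roots fun α hα => by
    by_contra! h
    exact hA α h (Polynomial.isRoot_of_mem_roots hα)
  rw [hs]
  refine ⟨fun k => ?_, fun t ht => ?_⟩
  · rw [Polynomial.coeff_C_mul, Polynomial.coeff_C_mul, norm_mul, norm_mul, mul_assoc]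
    exact mul_le_mul_of_nonneg_left (h1 k) (norm_nonneg _)
  · rw [Polynomial.eval_mul, Polynomial.eval_C, Polynomial.coeff_C_mul, norm_mul, norm_mul, h2 t ht]

/-- Quadratic closeness at a critical point, for a curve in an ultrametric disc that omits two
points. -/
theorem vdist_le_of_omits_two [IsUltrametricDist K] [IsAlgClosed K] {N : Fin 2 → Polynomial K}
    (hN : ∀ t, (fun i => (N i).eval t) ≠ 0) (hw : wronAt N 0 = 0) {p q : Fin 2 → K} (hp : p ≠ 0)
    (hq : q ≠ 0) {δ ρ : ℝ} (hδ : 0 < δ) (hρ : 0 < ρ) (hpq : δ ≤ vdist p q)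
    (h1 : ∀ t, ‖t‖ < ρ → wedge p (fun i => (N i).eval t) ≠ 0)
    (h2 : ∀ t, ‖t‖ < ρ → wedge q (fun i => (N i).eval t) ≠ 0) (t : K) (ht : ‖t‖ < ρ) :
    vdist (fun i => (N i).eval t) (fun i => (N i).eval 0) ≤ 1 / (δ * ρ ^ 2) * ‖t‖ ^ 2 := by
  set A := lpoly p N with hAdef
  set B := lpoly q N with hBdef
  obtain ⟨a1, a2⟩ := coeff_and_eval_bound hρ (A := A) fun t ht => by
    rw [hAdef, eval_lpoly]; exact h1 t ht
  obtain ⟨b1, b2⟩ := coeff_and_eval_bound hρ (A := B) fun t ht => by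
    rw [hBdef, eval_lpoly]; exact h2 t ht
  set u : Fin 2 → K := fun i => (N i).eval t with hu
  set v : Fin 2 → K := fun i => (N i).eval 0 with hv
  set H : Polynomial K := Polynomial.C (B.coeff 0) * A - Polynomial.C (A.coeff 0) * B with hH
  have hH0 : H.coeff 0 = 0 := by
    simp [hH]; ring
  have hH1 : H.coeff 1 = 0 := by
    have := lpoly_wronskian (p := p) (q := q) hw
    rw [← hAdef, ← hBdef, ← Polynomial.coeff_zero_eq_eval_zero, ← Polynomial.coeff_zero_eq_eval_zero,
      ← Polynomial.coeff_zero_eq_eval_zero, ← Polynomial.coeff_zero_eq_eval_zero,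
      Polynomial.coeff_derivative, Polynomial.coeff_derivative] at this
    simp at this
    simp [hH]
    linear_combination this
  have hHk : ∀ k, ‖H.coeff k‖ * ρ ^ k ≤ ‖A.coeff 0‖ * ‖B.coeff 0‖ := by
    intro k
    have e : H.coeff k = B.coeff 0 * A.coeff k - A.coeff 0 * B.coeff k := by
      simp [hH]
    have hmax : ‖H.coeff k‖ ≤ max ‖B.coeff 0 * A.coeff k‖ ‖A.coeff 0 * B.coeff k‖ := by
      rw [e]; exact norm_sub_le_max_norm _ _
    calc ‖H.coeff k‖ * ρ ^ k
        ≤ max ‖B.coeff 0 * A.coeff k‖ ‖A.coeff 0 * B.coeff k‖ * ρ ^ k := by gcongr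
      _ ≤ ‖A.coeff 0‖ * ‖B.coeff 0‖ := by
        rw [max_mul_of_nonneg _ _ (by positivity), norm_mul, norm_mul, mul_assoc, mul_assoc]
        refine max_le ?_ (mul_le_mul_of_nonneg_left (b1 k) (norm_nonneg _))
        rw [mul_comm ‖A.coeff 0‖]
        exact mul_le_mul_of_nonneg_left (a1 k) (norm_nonneg _)
  have hHt : ‖H.eval t‖ ≤ ‖A.coeff 0‖ * ‖B.coeff 0‖ * (‖t‖ / ρ) ^ 2 := by
    rw [Polynomial.eval_eq_sum_range]
    refine IsUltrametricDist.norm_sum_le_of_forall_le_of_nonneg (by positivity) fun k _ => ?_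
    rcases k with _ | _ | k
    · rw [hH0]; simp; positivity
    · rw [zero_add, hH1]; simp; positivity
    · have hx : ‖t‖ / ρ ≤ 1 := (div_le_one hρ).2 ht.le
      have h3 : ‖H.coeff (k + 1 + 1) * t ^ (k + 1 + 1)‖ =
          ‖H.coeff (k + 1 + 1)‖ * ρ ^ (k + 1 + 1) * (‖t‖ / ρ) ^ (k + 1 + 1) := by
        rw [norm_mul, norm_pow, div_pow]; field_simp
      rw [h3]
      exact mul_le_mul (hHk _) (pow_le_pow_of_le_one (by positivity) hx (by omega))
        (by positivity) (by positivity)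
  have hHw : H.eval t = wedge p q * wedge u v := by
    rw [← wedge_mul_wedge_sub, hu, hv, ← eval_lpoly, ← eval_lpoly, ← eval_lpoly, ← eval_lpoly,
      ← hAdef, ← hBdef, hH, Polynomial.coeff_zero_eq_eval_zero, Polynomial.coeff_zero_eq_eval_zero]
    simp
    ring
  have hwle : ∀ x y : Fin 2 → K, ‖wedge x y‖ ≤ ‖x‖ * ‖y‖ := by
    intro x y
    refine (norm_sub_le_max_norm _ _).trans (max_le ?_ ?_) <;>
    · rw [norm_mul]; gcongr <;> exact norm_le_pi_norm _ _
  have hA0 : ‖A.coeff 0‖ ≤ ‖p‖ * ‖u‖ := by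
    rw [← a2 t ht, hAdef, eval_lpoly]; exact hwle _ _
  have hB0 : ‖B.coeff 0‖ ≤ ‖q‖ * ‖v‖ := by
    rw [Polynomial.coeff_zero_eq_eval_zero, hBdef, eval_lpoly]; exact hwle _ _
  have hu0 := norm_pos_iff.2 (hN t)
  have hv0 := norm_pos_iff.2 (hN 0)
  have hp0 := norm_pos_iff.2 hp
  have hq0 := norm_pos_iff.2 hq
  rw [vdist, le_div_iff₀ (by positivity)] at hpq
  rw [vdist, div_le_iff₀ (by positivity)]
  have hmain : δ * (‖p‖ * ‖q‖) * ‖wedge u v‖ ≤ (‖p‖ * ‖u‖) * (‖q‖ * ‖v‖) * (‖t‖ / ρ) ^ 2 := by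
    calc δ * (‖p‖ * ‖q‖) * ‖wedge u v‖ ≤ ‖wedge p q‖ * ‖wedge u v‖ := by gcongr
      _ = ‖H.eval t‖ := by rw [hHw, norm_mul]
      _ ≤ _ := hHt
      _ ≤ _ := by gcongr
  have e : 1 / (δ * ρ ^ 2) * ‖t‖ ^ 2 * (‖u‖ * ‖v‖) =
      (‖p‖ * ‖u‖) * (‖q‖ * ‖v‖) * (‖t‖ / ρ) ^ 2 / (δ * (‖p‖ * ‖q‖)) := by
    field_simp
  rw [e, le_div_iff₀ (by positivity)]
  linarith

/-- Quadratic closeness at a critical point, for curves in an archimedean disc that omit three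
given points. -/
theorem exists_vdist_le_of_omits_three [CharZero K] [CompleteSpace K] [IsAlgClosed K]
    (harch : ¬ IsUltrametricDist K) {p q r : Fin 2 → K} (hpq : wedge p q ≠ 0) (hpr : wedge p r ≠ 0)
    (hqr : wedge r q ≠ 0) {ρ : ℝ} (hρ : 0 < ρ) (M : ℝ) :
    ∃ C ρ' : ℝ, 0 < C ∧ 0 < ρ' ∧ ∀ N : Fin 2 → Polynomial K, (∀ t, (fun i => (N i).eval t) ≠ 0) →
      wronAt N 0 = 0 → (∀ t, ‖t‖ < ρ → wedge p (fun i => (N i).eval t) ≠ 0) →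
      (∀ t, ‖t‖ < ρ → wedge q (fun i => (N i).eval t) ≠ 0) →
      (∀ t, ‖t‖ < ρ → wedge r (fun i => (N i).eval t) ≠ 0) →
      ‖wedge p (fun i => (N i).eval 0)‖ ≤ M * ‖wedge q (fun i => (N i).eval 0)‖ →
      ∀ t, ‖t‖ < ρ' → vdist (fun i => (N i).eval t) (fun i => (N i).eval 0) ≤ C * ‖t‖ ^ 2 := by
  obtain ⟨s, ψ, hs, hψ⟩ := exists_complex_ringEquiv harch
  have hφ : ∀ x : K, ‖ψ.symm x‖ = ‖x‖ ^ s⁻¹ := by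
    intro x
    have := hψ (ψ.symm x)
    rw [RingEquiv.apply_symm_apply] at this
    rw [this, ← Real.rpow_mul (norm_nonneg _), mul_inv_cancel₀ hs.ne', Real.rpow_one]
  set κ : K := -(wedge r q) / wedge p r with hκ
  have hκ0 : κ ≠ 0 := div_ne_zero (neg_ne_zero.2 hqr) hpr
  set R : ℝ := ρ ^ s⁻¹ with hR
  have hR0 : 0 < R := Real.rpow_pos_of_pos hρ _
  obtain ⟨C, hC, hbound⟩ := exists_sq_bound_of_omits ((‖κ‖ * max M 0) ^ s⁻¹) R hR0
  have hball : ∀ (w : ℂ) (x : ℝ), 0 ≤ x → ‖w‖ < x ^ s⁻¹ → ‖ψ w‖ < x := by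
    intro w x hx hw
    rw [hψ]
    calc ‖w‖ ^ s < (x ^ s⁻¹) ^ s := Real.rpow_lt_rpow (norm_nonneg _) hw hs
      _ = x := by rw [← Real.rpow_mul hx, inv_mul_cancel₀ hs.ne', Real.rpow_one]
  have hpos : 0 < ‖κ‖ * ‖wedge p q‖ := mul_pos (norm_pos_iff.2 hκ0) (norm_pos_iff.2 hpq)
  refine ⟨(4 * ‖q‖ ^ 2 * C ^ s + 1) / (‖κ‖ * ‖wedge p q‖), (R / 2) ^ s, by positivity,
    by positivity, ?_⟩
  intro N hN hw hp0 hq0 hr0 hM t ht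
  set A := lpoly p N with hA
  set B := lpoly q N with hB
  set φ : K →+* ℂ := (ψ.symm : K →+* ℂ) with hφdef
  have hφn : ∀ x, ‖φ x‖ = ‖x‖ ^ s⁻¹ := hφ
  have hev : ∀ (P : Polynomial K) (w : ℂ), (P.map φ).eval w = φ (P.eval (ψ w)) := by
    intro P w
    have : φ (ψ w) = w := ψ.symm_apply_apply w
    conv_lhs => rw [← this]
    exact Polynomial.eval_map_apply _ _
  set g : ℂ → ℂ := fun w => φ κ * ((A.map φ).eval w / (B.map φ).eval w) with hg
  have hmem : ∀ w ∈ Metric.ball (0 : ℂ) R, ‖ψ w‖ < ρ := fun w hw =>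
    hball w ρ hρ.le (by simpa using hw)
  have hA0 : ∀ w ∈ Metric.ball (0 : ℂ) R, (A.map φ).eval w ≠ 0 := fun w hw => by
    rw [hev, hA, eval_lpoly]; exact (map_ne_zero φ).2 (hp0 _ (hmem w hw))
  have hB0 : ∀ w ∈ Metric.ball (0 : ℂ) R, (B.map φ).eval w ≠ 0 := fun w hw => by
    rw [hev, hB, eval_lpoly]; exact (map_ne_zero φ).2 (hq0 _ (hmem w hw))
  have hgK : ∀ w, g w = φ (κ * (A.eval (ψ w) / B.eval (ψ w))) := fun w => by
    rw [map_mul, map_div₀ φ (A.eval _), ← hev, ← hev]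
  have hg1 : ∀ w ∈ Metric.ball (0 : ℂ) R, g w ≠ 1 := by
    intro w hw h
    rw [hgK, map_eq_one_iff φ φ.injective, hκ] at h
    refine hr0 _ (hmem w hw) ?_
    have hBw : B.eval (ψ w) ≠ 0 := by rw [hB, eval_lpoly]; exact hq0 _ (hmem w hw)
    field_simp at h
    rw [hA, hB, eval_lpoly, eval_lpoly] at h
    set u : Fin 2 → K := fun i => (N i).eval (ψ w)
    have e : wedge p q * wedge r u = wedge p r * wedge q u + wedge r q * wedge p u := by
      simp only [wedge]; ring
    have : wedge p q * wedge r u = 0 := by rw [e]; linear_combination -h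
    exact (mul_eq_zero.1 this).resolve_left hpq
  have hψ0 : ψ 0 = 0 := map_zero ψ
  have hBK : ∀ x, ‖x‖ < ρ → B.eval x ≠ 0 := fun x hx => by
    rw [hB, eval_lpoly]; exact hq0 x hx
  have hgM : ‖g 0‖ ≤ (‖κ‖ * max M 0) ^ s⁻¹ := by
    rw [hgK, hφn, hψ0, norm_mul, norm_div (A.eval _)]
    have hb := norm_pos_iff.2 (hBK 0 (by simpa using hρ))
    gcongr
    rw [div_le_iff₀ hb, hA, hB, eval_lpoly, eval_lpoly]
    refine hM.trans ?_
    gcongr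
    exact le_max_left _ _
  have hgd : HasDerivAt g 0 0 := by
    have h1 := ((A.map φ).hasDerivAt 0).div ((B.map φ).hasDerivAt 0)
      (hB0 0 (Metric.mem_ball_self hR0))
    have h2 := h1.const_mul (φ κ)
    refine h2.congr_deriv ?_
    rw [Polynomial.derivative_map, Polynomial.derivative_map, hev, hev, hev, hev, hψ0, ← map_mul,
      ← map_mul, ← map_sub, hA, hB, lpoly_wronskian hw, map_zero, zero_div, mul_zero]
  have hdiff : DifferentiableOn ℂ g (Metric.ball 0 R) :=
    (((A.map φ).differentiable.differentiableOn).div ((B.map φ).differentiable.differentiableOn)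
      hB0).const_mul _
  have hnt : ‖φ t‖ < R / 2 := by
    rw [hφn]
    calc ‖t‖ ^ s⁻¹ < ((R / 2) ^ s) ^ s⁻¹ :=
          Real.rpow_lt_rpow (norm_nonneg _) ht (inv_pos.2 hs)
      _ = R / 2 := by
        rw [← Real.rpow_mul (by positivity), mul_inv_cancel₀ hs.ne', Real.rpow_one]
  have hfin := hbound g hdiff (fun w hw => mul_ne_zero ((map_ne_zero φ).2 hκ0)
    (div_ne_zero (hA0 w hw) (hB0 w hw))) hg1 hgM hgd (φ t) (by simpa using hnt)
  have hψt : ψ (φ t) = t := ψ.apply_symm_apply t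
  have htρ : ‖t‖ < ρ := by
    have := hmem (φ t) (by simpa using hnt.trans (by linarith))
    rwa [hψt] at this
  rw [hgK, hgK, hψt, hψ0, ← map_sub, hφn, hφn] at hfin
  have hfin2 : ‖κ * (A.eval t / B.eval t) - κ * (A.eval 0 / B.eval 0)‖ ≤ C ^ s * ‖t‖ ^ 2 := by
    have h1 := Real.rpow_le_rpow (by positivity) hfin hs.le
    rw [← Real.rpow_mul (norm_nonneg _), inv_mul_cancel₀ hs.ne', Real.rpow_one,
      Real.mul_rpow hC.le (by positivity), ← Real.rpow_natCast, ← Real.rpow_mul (by positivity),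
      ← Real.rpow_mul (norm_nonneg _)] at h1
    have : s⁻¹ * ((2 : ℕ) * s) = (2 : ℕ) := by field_simp
    rwa [this, Real.rpow_natCast] at h1
  set u : Fin 2 → K := fun i => (N i).eval t with hu
  set v : Fin 2 → K := fun i => (N i).eval 0 with hv
  have hBt := hBK t htρ
  have hB0' := hBK 0 (by simpa using hρ)
  have hkey : κ * (wedge p q * wedge u v) =
      (κ * (A.eval t / B.eval t) - κ * (A.eval 0 / B.eval 0)) * (B.eval t * B.eval 0) := by
    have : wedge p q * wedge u v = A.eval t * B.eval 0 - A.eval 0 * B.eval t := by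
      rw [hA, hB, eval_lpoly, eval_lpoly, eval_lpoly, eval_lpoly, ← wedge_mul_wedge_sub]
    rw [this]
    field_simp
  have hBt' : ‖B.eval t‖ ≤ 2 * (‖q‖ * ‖u‖) := by rw [hB, eval_lpoly]; exact norm_wedge_le _ _
  have hB0'' : ‖B.eval 0‖ ≤ 2 * (‖q‖ * ‖v‖) := by rw [hB, eval_lpoly]; exact norm_wedge_le _ _
  have hu0 := norm_pos_iff.2 (hN t)
  have hv0 := norm_pos_iff.2 (hN 0)
  have hmain : ‖κ‖ * ‖wedge p q‖ * ‖wedge u v‖ ≤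
      C ^ s * ‖t‖ ^ 2 * (2 * (‖q‖ * ‖u‖) * (2 * (‖q‖ * ‖v‖))) := by
    calc ‖κ‖ * ‖wedge p q‖ * ‖wedge u v‖ = ‖κ * (wedge p q * wedge u v)‖ := by
          rw [norm_mul, norm_mul, mul_assoc]
      _ = _ := by rw [hkey, norm_mul, norm_mul]
      _ ≤ _ := by gcongr
  rw [vdist, div_le_iff₀ (by positivity)]
  have e : (4 * ‖q‖ ^ 2 * C ^ s + 1) / (‖κ‖ * ‖wedge p q‖) * ‖t‖ ^ 2 * (‖u‖ * ‖v‖) =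
      (4 * ‖q‖ ^ 2 * C ^ s + 1) * ‖t‖ ^ 2 * (‖u‖ * ‖v‖) / (‖κ‖ * ‖wedge p q‖) := by ring
  rw [e, le_div_iff₀ hpos]
  have : 0 ≤ ‖t‖ ^ 2 * (‖u‖ * ‖v‖) := by positivity
  nlinarith

end Quadratic

section Recurrence

variable {K : Type*} [NontriviallyNormedField K]

theorem exists_iterate_liftVec_smul (f : RatFunc K) (n : ℕ) {a : K} (ha : a ≠ 0) (p : Fin 2 → K) :
    ∃ b : K, b ≠ 0 ∧ (liftVec f)^[n] (a • p) = b • (liftVec f)^[n] p := by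
  induction n with
  | zero => exact ⟨a, ha, rfl⟩
  | succ n ih =>
    obtain ⟨b, hb, h⟩ := ih
    refine ⟨b ^ ratDegree f, pow_ne_zero _ hb, ?_⟩
    rw [Function.iterate_succ_apply', h, liftVec_smul, Function.iterate_succ_apply']

/-- Near the point with coordinate `t₀`, the affine coordinate is Lipschitz for the chordal
metric. -/
theorem exists_eq_smul_chartVec {i : Fin 2} {t₀ : K} {v : Fin 2 → K} (hv : v ≠ 0)
    (h : vdist v (chartVec i t₀) < 1 / (2 * max 1 ‖t₀‖)) :
    ∃ a t : K, a ≠ 0 ∧ v = a • chartVec i (t + t₀) ∧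
      ‖t‖ ≤ 2 * max 1 ‖t₀‖ ^ 2 * vdist v (chartVec i t₀) := by
  set m := max 1 ‖t₀‖ with hm
  have hm1 : 1 ≤ m := le_max_left _ _
  have hvi : v i ≠ 0 := by
    intro hvi
    have hv' : 0 < ‖v (i + 1)‖ := by
      rw [norm_pos_iff]
      intro h0
      refine hv ?_
      ext k
      fin_cases i <;> fin_cases k <;> simp_all
    have e : vdist v (chartVec i t₀) = 1 / m := by
      have hn : ‖v‖ = ‖v (i + 1)‖ := by
        rw [norm_vec_eq]
        fin_cases i <;> simp at hvi <;> simp [hvi]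
      have hw : ‖wedge v (chartVec i t₀)‖ = ‖v (i + 1)‖ := by
        fin_cases i <;> simp at hvi <;> simp [wedge, chartVec, hvi]
      rw [vdist, hn, hw, norm_chartVec, ← hm]
      field_simp
    rw [e, div_lt_div_iff₀ (by positivity) (by positivity)] at h
    linarith
  have hveq : v = v i • chartVec i (v (i + 1) / v i) := by
    ext k
    fin_cases i <;> fin_cases k <;> simp [chartVec] at hvi ⊢ <;> field_simp
  refine ⟨v i, v (i + 1) / v i - t₀, hvi, by rw [sub_add_cancel]; exact hveq, ?_⟩
  set τ := v (i + 1) / v i with hτ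
  set β := vdist v (chartVec i t₀) with hβ
  have hβe : β = ‖τ - t₀‖ / (max 1 ‖τ‖ * m) := by
    rw [hβ, hveq, vdist_smul_left hvi, vdist, norm_chartVec, norm_chartVec, norm_wedge_chartVec,
      norm_sub_rev]
  have hτm : max 1 ‖τ‖ ≤ m + ‖τ - t₀‖ := by
    refine max_le (by linarith [norm_nonneg (τ - t₀)]) ?_
    have := norm_add_le (τ - t₀) t₀
    rw [sub_add_cancel] at this
    linarith [le_max_right 1 ‖t₀‖]
  have hpos : 0 < max 1 ‖τ‖ * m := by positivity
  rw [eq_div_iff hpos.ne'] at hβe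
  have hβ0 : 0 ≤ β := vdist_nonneg _ _
  rw [lt_div_iff₀ (by positivity)] at h
  have h1 : ‖τ - t₀‖ ≤ β * ((m + ‖τ - t₀‖) * m) := by
    calc ‖τ - t₀‖ = β * (max 1 ‖τ‖ * m) := hβe.symm
      _ ≤ _ := by gcongr
  nlinarith [norm_nonneg (τ - t₀)]

/-- The quadratic contraction of the iterates returning near a critical point of the Fatou set, in
the standard chart. -/
theorem exists_quadratic_bound_chart [CompleteSpace K] [IsAlgClosed K] [CharZero K]
    {f : RatFunc K} (hf : 1 ≤ ratDegree f) {i : Fin 2} {t₀ : K}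
    (hw : ∀ n, 1 ≤ n → wronAt ((liftPoly f)^[n] (chartPoly i t₀)) 0 = 0)
    (hF : chartPt i t₀ ∈ fatou f)
    (hper : ∀ n, 1 ≤ n → (ratMap f)^[n] (Projectivization.mk K _ (chartVec_ne_zero i t₀)) ≠
      Projectivization.mk K _ (chartVec_ne_zero i t₀)) :
    ∃ C ρ η : ℝ, 0 < C ∧ 0 < ρ ∧ 0 < η ∧ ∀ n, 1 ≤ n →
      vdist ((liftVec f)^[n] (chartVec i t₀)) (chartVec i t₀) < η → ∀ t, ‖t‖ < ρ →
      vdist ((liftVec f)^[n] (chartVec i (t + t₀))) ((liftVec f)^[n] (chartVec i t₀)) ≤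
        C * ‖t‖ ^ 2 := by
  obtain ⟨b, hbE, V, hV, hcV, hbV⟩ := exists_omitted_of_mem_fatou hf hF hper
  obtain ⟨A, hAc, hAcl, hAV⟩ := exists_mem_nhds_isClosed_subset (hV.mem_nhds hcV)
  have hbA : ∀ n, 1 ≤ n → b ∉ (BerkP1.map f)^[n] '' A := fun n hn h =>
    hbV n hn (Set.image_mono hAV h)
  obtain ⟨ρ, hρ, hρA⟩ : ∃ ρ : ℝ, 0 < ρ ∧ ∀ t : K, ‖t‖ < ρ → chartPt i (t + t₀) ∈ A := by
    have hcont : Tendsto (fun t : K => chartPt i (t + t₀)) (𝓝 0) (𝓝 (chartPt i t₀)) := by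
      have := ((continuous_chartPt i).comp (continuous_add_const t₀)).tendsto (0 : K)
      simpa [Function.comp_def] using this
    obtain ⟨ρ, hρ, h⟩ := Metric.eventually_nhds_iff.1 (hcont.eventually hAc)
    exact ⟨ρ, hρ, fun t ht => h (by simpa using ht)⟩
  have heval : ∀ n t, (fun k => ((liftPoly f)^[n] (chartPoly i t₀) k).eval t) =
      (liftVec f)^[n] (chartVec i (t + t₀)) := fun n t => by
    rw [eval_iterate_liftPoly, eval_chartPoly]
  have hne : ∀ n t, (fun k => ((liftPoly f)^[n] (chartPoly i t₀) k).eval t) ≠ 0 := fun n t => by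
    rw [heval]; exact iterate_liftVec_ne_zero f (chartVec_ne_zero _ _) n
  have hwedge : ∀ n t (p : Fin 2 → K) (hp : p ≠ 0),
      BerkP1.ofP1 (Projectivization.mk K p hp) ≠ (BerkP1.map f)^[n] (chartPt i (t + t₀)) →
      wedge p (fun k => ((liftPoly f)^[n] (chartPoly i t₀) k).eval t) ≠ 0 := by
    intro n t p hp h h0
    refine h ?_
    rw [iterate_map_chartPt]
    congr 1
    rw [mk_eq_mk_iff_wedge, ← heval]
    exact h0
  by_cases hum : IsUltrametricDist K
  · have hpair : ∃ δ : ℝ, 0 < δ ∧ ∀ n, 1 ≤ n → ∃ (p q : Fin 2 → K) (hp : p ≠ 0) (hq : q ≠ 0),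
        δ ≤ vdist p q ∧ ∀ t, ‖t‖ < ρ →
          BerkP1.ofP1 (Projectivization.mk K p hp) ≠ (BerkP1.map f)^[n] (chartPt i (t + t₀)) ∧
          BerkP1.ofP1 (Projectivization.mk K q hq) ≠ (BerkP1.map f)^[n] (chartPt i (t + t₀)) := by
      by_cases hb : b ∈ Set.range (BerkP1.ofP1 (K := K))
      · obtain ⟨z, hz, w, hwz, hzw⟩ := (infinite_omitted hf hb hbE hbA).nontrivial
        refine ⟨vdist z.rep w.rep, ?_, fun n hn => ⟨z.rep, w.rep, z.rep_nonzero, w.rep_nonzero,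
          le_rfl, fun t ht => ⟨fun h => hz n hn ?_, fun h => hwz n hn ?_⟩⟩⟩
        · refine lt_of_le_of_ne (vdist_nonneg _ _) fun h => hzw ?_
          rw [← z.mk_rep, ← w.mk_rep, mk_eq_mk_iff_wedge]
          exact (vdist_eq_zero_iff z.rep_nonzero w.rep_nonzero).1 h.symm
        · rw [← z.mk_rep, h]; exact ⟨_, hρA t ht, rfl⟩
        · rw [← w.mk_rep, h]; exact ⟨_, hρA t ht, rfl⟩
      · obtain ⟨δ, hδ, hfar⟩ := exists_far_pair_of_mem_nhds hb
        refine ⟨δ, hδ, fun n hn => ?_⟩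
        obtain ⟨W, hW, hWt⟩ := exists_nhds_forall_notMem f n hAcl hρA (hbA n hn)
        obtain ⟨p, q, hp, hq, hpW, hqW, hpq⟩ := hfar W hW
        exact ⟨p, q, hp, hq, hpq, fun t ht =>
          ⟨fun h => hWt t ht (h ▸ hpW), fun h => hWt t ht (h ▸ hqW)⟩⟩
    obtain ⟨δ, hδ, hpair⟩ := hpair
    refine ⟨1 / (δ * ρ ^ 2), ρ, 1, by positivity, hρ, one_pos, fun n hn _ t ht => ?_⟩
    obtain ⟨p, q, hp, hq, hpq, hom⟩ := hpair n hn
    have := vdist_le_of_omits_two (hne n) (hw n hn) hp hq hδ hρ hpq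
      (fun t ht => hwedge n t p hp (hom t ht).1) (fun t ht => hwedge n t q hq (hom t ht).2) t ht
    rwa [heval, heval, zero_add] at this
  · have hb : b ∈ Set.range (BerkP1.ofP1 (K := K)) := by
      induction b using Quotient.inductionOn with | h x => ?_
      obtain ⟨p, hp, hxp⟩ := x.exists_nrm_eq_norm_eval hum
      refine ⟨Projectivization.mk K p hp, ?_⟩
      rw [ofP1_mk]
      exact Quotient.sound ⟨1, one_pos, fun n G _ => by rw [one_pow, one_mul, hxp]; rfl⟩
    set c : P1 K := Projectivization.mk K _ (chartVec_ne_zero i t₀) with hc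
    obtain ⟨T, hT, hTc⟩ := ((infinite_omitted hf hb hbE hbA).sdiff
      (Set.finite_singleton c)).exists_subset_card_eq 3
    classical
    obtain ⟨x, y, z, hxy, hxz, hyz, rfl⟩ := Finset.card_eq_three.1 hTc
    have hx := hT (show x ∈ _ by simp)
    have hy := hT (show y ∈ _ by simp)
    have hz := hT (show z ∈ _ by simp)
    have hwne : ∀ z w : P1 K, z ≠ w → wedge z.rep w.rep ≠ 0 := fun z w hzw h => hzw (by
      rw [← z.mk_rep, ← w.mk_rep, mk_eq_mk_iff_wedge]; exact h)
    have hyc : 0 < vdist y.rep (chartVec i t₀) := by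
      refine lt_of_le_of_ne (vdist_nonneg _ _) fun h => hy.2 ?_
      rw [Set.mem_singleton_iff, ← y.mk_rep, hc, mk_eq_mk_iff_wedge]
      exact (vdist_eq_zero_iff y.rep_nonzero (chartVec_ne_zero i t₀)).1 h.symm
    have hy0 := norm_pos_iff.2 y.rep_nonzero
    obtain ⟨C, ρ', hC, hρ', hbound⟩ := exists_vdist_le_of_omits_three hum (hwne x y hxy)
      (hwne x z hxz) (hwne z y hyz.symm) hρ
      (4 * ‖x.rep‖ / (‖y.rep‖ * vdist y.rep (chartVec i t₀)))
    refine ⟨C, ρ', vdist y.rep (chartVec i t₀) / 2, hC, hρ', half_pos hyc, fun n hn hret t ht => ?_⟩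
    have hom : ∀ u : P1 K, (∀ n, 1 ≤ n → BerkP1.ofP1 u ∉ (BerkP1.map f)^[n] '' A) →
        ∀ t, ‖t‖ < ρ →
          wedge u.rep (fun k => ((liftPoly f)^[n] (chartPoly i t₀) k).eval t) ≠ 0 := by
      intro u hu t ht
      refine hwedge n t u.rep u.rep_nonzero fun h => hu n hn ?_
      rw [← u.mk_rep, h]
      exact ⟨_, hρA t ht, rfl⟩
    have := hbound _ (hne n) (hw n hn) (hom x hx.1) (hom y hy.1) (hom z hz.1) (by
      rw [heval, zero_add]
      set v := (liftVec f)^[n] (chartVec i t₀) with hv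
      have hv0 : v ≠ 0 := iterate_liftVec_ne_zero f (chartVec_ne_zero i t₀) n
      have hvn := norm_pos_iff.2 hv0
      have h1 := norm_wedge_le x.rep v
      have h2 := vdist_triangle y.rep_nonzero hv0 (chartVec_ne_zero i t₀)
      have h3 : vdist y.rep (chartVec i t₀) / 2 ≤ vdist y.rep v := by linarith
      have h4 : ‖wedge y.rep v‖ = vdist y.rep v * (‖y.rep‖ * ‖v‖) := by
        rw [vdist]; field_simp
      rw [h4]
      calc ‖wedge x.rep v‖ ≤ 2 * (‖x.rep‖ * ‖v‖) := h1
        _ = 4 * ‖x.rep‖ / (‖y.rep‖ * vdist y.rep (chartVec i t₀)) *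
            (vdist y.rep (chartVec i t₀) / 2 * (‖y.rep‖ * ‖v‖)) := by field_simp; ring
        _ ≤ _ := by gcongr) t ht
    rwa [heval, heval, zero_add] at this

/-- The quadratic contraction of the iterates returning near a critical point of the Fatou set. -/
theorem exists_quadratic_bound [CompleteSpace K] [IsAlgClosed K] [CharZero K]
    {f : RatFunc K} (hf : 1 ≤ ratDegree f) {i : Fin 2} {t₀ : K}
    (hw : ∀ n, 1 ≤ n → wronAt ((liftPoly f)^[n] (chartPoly i t₀)) 0 = 0)
    (hF : chartPt i t₀ ∈ fatou f)
    (hper : ∀ n, 1 ≤ n → (ratMap f)^[n] (Projectivization.mk K _ (chartVec_ne_zero i t₀)) ≠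
      Projectivization.mk K _ (chartVec_ne_zero i t₀)) :
    ∃ C η : ℝ, 0 < C ∧ 0 < η ∧ ∀ n, 1 ≤ n →
      vdist ((liftVec f)^[n] (chartVec i t₀)) (chartVec i t₀) < η → ∀ v, v ≠ 0 →
      vdist v (chartVec i t₀) < η →
      vdist ((liftVec f)^[n] v) ((liftVec f)^[n] (chartVec i t₀)) ≤
        C * vdist v (chartVec i t₀) ^ 2 := by
  obtain ⟨C, ρ, η, hC, hρ, hη, h⟩ := exists_quadratic_bound_chart hf hw hF hper
  set m := max 1 ‖t₀‖ with hm
  have hm0 : 0 < m := lt_of_lt_of_le one_pos (le_max_left _ _)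
  refine ⟨C * (2 * m ^ 2) ^ 2, min η (min (1 / (2 * m)) (ρ / (2 * m ^ 2))), by positivity,
    by positivity, fun n hn hret v hv hvd => ?_⟩
  simp only [lt_min_iff] at hret hvd
  obtain ⟨a, t, ha, rfl, ht⟩ := exists_eq_smul_chartVec hv hvd.2.1
  obtain ⟨b, hb, hbe⟩ := exists_iterate_liftVec_smul f n ha (chartVec i (t + t₀))
  rw [hbe, vdist_smul_left hb]
  have htρ : ‖t‖ < ρ := by
    refine ht.trans_lt ?_
    have := hvd.2.2
    rwa [lt_div_iff₀' (by positivity)] at this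
  refine (h n hn hret.1 t htρ).trans ?_
  rw [mul_assoc, ← mul_pow]
  gcongr

end Recurrence

end BerkDyn

end

theorem fatou_critical_point_nonrecurrent {K : Type*} [NontriviallyNormedField K]
    [CompleteSpace K] [IsAlgClosed K] [CharZero K]
    (f : RatFunc K) (hf : 1 < BerkDyn.ratDegree f)
    (c : BerkDyn.P1 K) (hcrit : c ∈ BerkDyn.critSet (BerkDyn.ratMap f))
    (hFatou : BerkDyn.BerkP1.ofP1 c ∈ BerkDyn.fatou f)
    (hsat : c ∉ BerkDyn.superattracting f) :
    0 < Filter.liminf (fun n : ℕ => BerkDyn.chordal ((BerkDyn.ratMap f)^[n] c) c)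
      Filter.atTop := by
  open BerkDyn in
  have hper : ∀ n, 1 ≤ n → (ratMap f)^[n] c ≠ c := fun n hn h =>
    hsat (mem_superattracting_of_periodic hcrit hn h)
  obtain ⟨i, t₀, rfl, hw⟩ := wronAt_of_mem_critSet hcrit
  obtain ⟨C, η, hC, hη, hquad⟩ := exists_quadratic_bound hf.le hw hFatou hper
  set p := chartVec i t₀ with hp
  have hp0 : p ≠ 0 := chartVec_ne_zero i t₀
  have hn0 : ∀ n, (liftVec f)^[n] p ≠ 0 := iterate_liftVec_ne_zero f hp0
  by_contra hlim
  have hret : ∀ ε : ℝ, 0 < ε → ∃ n, 1 ≤ n ∧ vdist ((liftVec f)^[n] p) p < ε := by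
    intro ε hε
    by_contra! hfar
    refine hlim (lt_of_lt_of_le (by positivity : 0 < ε / 4) (Filter.le_liminf_of_le ?_ ?_))
    · exact (Filter.isBoundedUnder_of ⟨2, fun n => chordal_le_two _ _⟩).isCoboundedUnder_ge
    · filter_upwards [Filter.eventually_ge_atTop 1] with n hn
      have h1 := vdist_rep_le ((ratMap f)^[n] (Projectivization.mk K p hp0))
        (Projectivization.mk K p hp0)
      rw [iterate_ratMap_mk, vdist_rep_mk, ← iterate_ratMap_mk f p hp0 n] at h1
      linarith [hfar n hn]
  have hpos : ∀ n, 1 ≤ n → 0 < vdist ((liftVec f)^[n] p) p := by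
    intro n hn
    refine lt_of_le_of_ne (vdist_nonneg _ _) fun h => hper n hn ?_
    rw [iterate_ratMap_mk, mk_eq_mk_iff_wedge]
    exact (vdist_eq_zero_iff (hn0 n) hp0).1 h.symm
  obtain ⟨n, hn, hα⟩ := hret (min η (1 / (4 * C))) (by positivity)
  have hα0 := hpos n hn
  obtain ⟨m, hm, hβ⟩ := hret (min η (vdist ((liftVec f)^[n] p) p / 4)) (by positivity)
  rw [lt_min_iff] at hα hβ
  set a := (liftVec f)^[n] p with ha
  set b := (liftVec f)^[m] p with hb
  have hcomm : (liftVec f)^[n] b = (liftVec f)^[m] a := by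
    rw [ha, hb, ← Function.iterate_add_apply, ← Function.iterate_add_apply, add_comm]
  have h1 := hquad n hn hα.1 b (hn0 m) hβ.1
  have h2 := hquad m hm hβ.1 a (hn0 n) hα.1
  rw [← ha] at h1
  rw [← hb, ← hcomm] at h2
  have hx0 : (liftVec f)^[n] b ≠ 0 := iterate_liftVec_ne_zero f (hn0 m) n
  have h3 := vdist_triangle (hn0 n) hx0 (hn0 m)
  have h4 := vdist_triangle (hn0 n) (hn0 m) hp0
  rw [← ha, ← hb, vdist_comm a ((liftVec f)^[n] b)] at h3
  rw [← ha, ← hb] at h4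
  have hβ0 := vdist_nonneg b p
  have hα2 := hα.2
  rw [lt_div_iff₀ (by positivity)] at hα2
  set α := vdist a p with hαdef
  set β := vdist b p with hβdef
  have h5 : C * β ^ 2 ≤ C * α ^ 2 := by
    have : β ≤ α := by linarith [hβ.2]
    gcongr
  have h6 : α * (α * (4 * C)) ≤ α * 1 := by gcongr
  linarith [hβ.2, (by ring : α * (α * (4 * C)) = 4 * (C * α ^ 2))]
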